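/- arXiv:1606.02097 — 2 statements merged into one kernel-verified Lean document; each statement's English description precedes it below -/
import Mathlib

section
/- Let p > 5 be a prime, let V be a nonzero finite-dimensional vector space over the field F_p with p elements, and let ρ : Alt(5) → GL(V) be a faithful irreducible linear representation of the alternating group Alt(5). Suppose H is a subgroup of Alt(5) of index 5 and there exists a nonzero vector of V fixed by ρ(h) for every h ∈ H. Then dim V = 4. -/
open MulAction

/-- The vectors of a `G`-equivariant family indexed by a doubly transitive `G`-set, if they are
nonzero and sum to zero, satisfy only the obvious linear relations, provided that `|G|` is nonzero
in the base field. -/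
theorem card_mul_eq_sum_of_sum_smul_eq_zero {G Ω K V : Type*} [Group G] [Finite G] [MulAction G Ω]
    [Fintype Ω] [Field K] [AddCommGroup V] [Module K V] [IsMultiplyPretransitive G Ω 2]
    (hG : (Nat.card G : K) ≠ 0)
    (ρ : G →* (V →ₗ[K] V)ˣ) (y : Ω → V)
    (hy : ∀ g ω, (ρ g : V →ₗ[K] V) (y ω) = y (g • ω))
    (hne : ∀ ω, y ω ≠ 0) (hsum : ∑ ω, y ω = 0) (c : Ω → K) (hc : ∑ ω, c ω • y ω = 0) (i : Ω) :
    (Fintype.card Ω : K) * c i = ∑ ω, c ω := by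
  classical
  cases nonempty_fintype (stabilizer G i)
  let T : V →ₗ[K] V := ∑ h : stabilizer G i, (ρ h : V →ₗ[K] V)
  let N : K := Fintype.card (stabilizer G i)
  have hN : N ≠ 0 := by
    intro h
    apply hG
    rw [← Subgroup.index_mul_card (stabilizer G i), Nat.card_eq_fintype_card (α := stabilizer G i),
      Nat.cast_mul]
    exact mul_eq_zero_of_right _ h
  have hTi : T (y i) = N • y i := by
    have (h : stabilizer G i) : (ρ h : V →ₗ[K] V) (y i) = y i := by
      rw [hy, mem_stabilizer_iff.mp h.2]
    simp [T, N, LinearMap.sum_apply, this, Nat.cast_smul_eq_nsmul]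
  have hTeq (j k : Ω) (hj : i ≠ j) (hk : i ≠ k) : T (y j) = T (y k) := by
    obtain ⟨g, hgi, hgj⟩ := is_two_pretransitive_iff.mp ‹_› hj hk
    simp only [T, LinearMap.sum_apply, hy]
    refine Fintype.sum_equiv (Equiv.mulRight (⟨g, hgi⟩ : stabilizer G i)⁻¹) _ _ fun h ↦ ?_
    simp [← hgj, mul_smul]
  have hrest : ∑ ω ∈ Finset.univ.erase i, T (y ω) = -(N • y i) := by
    rw [← hTi, ← map_sum, eq_neg_iff_add_eq_zero, ← map_add,
      Finset.sum_erase_add _ _ (Finset.mem_univ i), hsum, map_zero]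
  have hT (j : Ω) (hj : i ≠ j) : (Fintype.card Ω - 1 : K) • T (y j) = -(N • y i) := by
    rw [← hrest, Finset.sum_congr rfl fun ω hω ↦ hTeq ω j (Finset.ne_of_mem_erase hω).symm hj,
      Finset.sum_const, Finset.card_erase_of_mem (Finset.mem_univ i), Finset.card_univ,
      ← Nat.cast_smul_eq_nsmul K, Nat.cast_sub (Fintype.card_pos_iff.mpr ⟨i⟩), Nat.cast_one]
  have key : ((Fintype.card Ω : K) * c i - ∑ ω, c ω) • N • y i = 0 := by
    have h := congrArg (fun v ↦ (Fintype.card Ω - 1 : K) • T v) hc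
    simp only [map_sum, map_smul, map_zero, smul_zero] at h
    rw [← Finset.sum_erase_add _ _ (Finset.mem_univ i), smul_add, Finset.smul_sum,
      Finset.sum_congr rfl fun ω hω ↦ by
        rw [smul_comm, hT ω (Finset.ne_of_mem_erase hω).symm, smul_neg, ← neg_smul],
      ← Finset.sum_smul, Finset.sum_neg_distrib, hTi, smul_smul _ (c i), ← add_smul] at h
    rw [← h, ← Finset.sum_erase_add _ c (Finset.mem_univ i)]
    congr 1
    ring
  rw [smul_smul] at key
  simpa [sub_eq_zero, hN, hne i] using key

/-- If `V` is spanned by such a family, its dimension is one less than the size of the set. -/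
theorem finrank_add_one_eq_card {G Ω K V : Type*} [Group G] [Finite G] [MulAction G Ω]
    [Fintype Ω] [Nonempty Ω] [Field K] [AddCommGroup V] [Module K V]
    [IsMultiplyPretransitive G Ω 2]
    (hG : (Nat.card G : K) ≠ 0) (hΩ : (Fintype.card Ω : K) ≠ 0)
    (ρ : G →* (V →ₗ[K] V)ˣ) (y : Ω → V)
    (hy : ∀ g ω, (ρ g : V →ₗ[K] V) (y ω) = y (g • ω))
    (hne : ∀ ω, y ω ≠ 0) (hsum : ∑ ω, y ω = 0) (hspan : Submodule.span K (Set.range y) = ⊤) :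
    Module.finrank K V + 1 = Fintype.card Ω := by
  have hker : (Fintype.linearCombination K y).ker = K ∙ (1 : Ω → K) := by
    ext c
    rw [LinearMap.mem_ker, Fintype.linearCombination_apply, Submodule.mem_span_singleton]
    constructor
    · intro hc
      refine ⟨(Fintype.card Ω : K)⁻¹ * ∑ ω, c ω, funext fun i ↦ ?_⟩
      rw [← card_mul_eq_sum_of_sum_smul_eq_zero hG ρ y hy hne hsum c hc i]
      simp [hΩ]
    · rintro ⟨a, rfl⟩
      simp [← Finset.smul_sum, hsum]
  have h := (Fintype.linearCombination K y).finrank_range_add_finrank_ker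
  rwa [Fintype.range_linearCombination, hspan, finrank_top, hker,
    finrank_span_singleton one_ne_zero, Module.finrank_fintype_fun_eq_card] at h

/-- A faithful irreducible representation of `G` in which `H` has a nonzero fixed vector has dimension
one less than the index of `H`, if `G` is doubly transitive on `G ⧸ H` and `|G|` is nonzero in the
base field. -/
theorem finrank_add_one_eq_index {G K V : Type*} [Group G] [Finite G] [Nontrivial G] [Field K]
    [AddCommGroup V] [Module K V] (hG : (Nat.card G : K) ≠ 0) (ρ : G →* (V →ₗ[K] V)ˣ)
    (hfaithful : Function.Injective ρ)
    (hirr : ∀ W : Submodule K V,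
      (∀ g, ∀ w ∈ W, (ρ g : V →ₗ[K] V) w ∈ W) → W = ⊥ ∨ W = ⊤)
    (H : Subgroup G) [IsMultiplyPretransitive G (G ⧸ H) 2]
    (x : V) (hx : x ≠ 0) (hfix : ∀ h ∈ H, (ρ h : V →ₗ[K] V) x = x) :
    Module.finrank K V + 1 = H.index := by
  classical
  cases nonempty_fintype (G ⧸ H)
  let y : G ⧸ H → V := Quotient.lift (fun g : G ↦ (ρ g : V →ₗ[K] V) x) fun a b hab ↦ by
    have := hfix _ (QuotientGroup.leftRel_apply.mp hab)
    conv_lhs => rw [← this]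
    simp [← Module.End.mul_apply, ← Units.val_mul, ← map_mul]
  have hy (g : G) (ω : G ⧸ H) : (ρ g : V →ₗ[K] V) (y ω) = y (g • ω) := by
    induction ω using Quotient.inductionOn with
    | h a =>
      change _ = (ρ (g * a) : V →ₗ[K] V) x
      rw [map_mul, Units.val_mul]
      rfl
  have hne (ω : G ⧸ H) : y ω ≠ 0 := by
    induction ω using Quotient.inductionOn with
    | h a =>
      intro h
      apply hx
      have := congrArg ((ρ a)⁻¹ : (V →ₗ[K] V)ˣ).val h
      change (((ρ a)⁻¹ : (V →ₗ[K] V)ˣ).val * (ρ a).val) x = _ at this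
      simpa using this
  have hsum : ∑ ω, y ω = 0 := by
    by_contra hs
    have hfixed (g : G) : (ρ g : V →ₗ[K] V) (∑ ω, y ω) = ∑ ω, y ω := by
      simp only [map_sum, hy]
      exact Equiv.sum_comp (MulAction.toPerm g) y
    have htop := (hirr (K ∙ ∑ ω, y ω) fun g w hw ↦ by
      obtain ⟨a, rfl⟩ := Submodule.mem_span_singleton.mp hw
      rwa [map_smul, hfixed]).resolve_left (by simpa using hs)
    have hone (g : G) : ρ g = 1 := by
      ext v
      obtain ⟨a, rfl⟩ := Submodule.mem_span_singleton.mp (htop ▸ Submodule.mem_top (x := v))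
      simp only [map_smul, hfixed]
      simp
    have : Subsingleton G := ⟨fun a b ↦ hfaithful ((hone a).trans (hone b).symm)⟩
    exact not_subsingleton G this
  have hspan : Submodule.span K (Set.range y) = ⊤ := by
    refine (hirr _ fun g w hw ↦ ?_).resolve_left fun h ↦ ?_
    · have := Submodule.mem_map_of_mem (f := (ρ g : V →ₗ[K] V)) hw
      rw [Submodule.map_span] at this
      refine Submodule.span_mono ?_ this
      rintro _ ⟨_, ⟨ω, rfl⟩, rfl⟩
      exact ⟨g • ω, (hy g ω).symm⟩
    · exact hne (1 : G) (Submodule.span_eq_bot.mp h _ ⟨_, rfl⟩)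
  have hcard : Fintype.card (G ⧸ H) = H.index := by
    rw [Subgroup.index_eq_card, Nat.card_eq_fintype_card]
  have hH : (Fintype.card (G ⧸ H) : K) ≠ 0 := by
    intro h
    apply hG
    rw [← H.index_mul_card, ← hcard, Nat.cast_mul, h, zero_mul]
  rw [← hcard]
  exact finrank_add_one_eq_card hG hH ρ y hy hne hsum hspan

/-- The alternating group on five letters is doubly transitive on the cosets of any subgroup of
index five. -/
theorem isMultiplyPretransitive_quotient (H : Subgroup (alternatingGroup (Fin 5)))
    (hH : H.index = 5) :
    IsMultiplyPretransitive (alternatingGroup (Fin 5)) (alternatingGroup (Fin 5) ⧸ H) 2 := by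
  classical
  cases nonempty_fintype (alternatingGroup (Fin 5) ⧸ H)
  let φ := toPermHom (alternatingGroup (Fin 5)) (alternatingGroup (Fin 5) ⧸ H)
  have hcard : Nat.card (alternatingGroup (Fin 5) ⧸ H) = 5 := by
    rw [← Subgroup.index_eq_card, hH]
  have : Nontrivial (alternatingGroup (Fin 5) ⧸ H) :=
    Finite.one_lt_card_iff_nontrivial.mp (by omega)
  have hker : φ.ker = ⊥ := by
    refine (φ.normal_ker.eq_bot_or_eq_top).resolve_right fun h ↦ ?_
    rw [← Subgroup.normalCore_eq_ker] at h
    have : H = ⊤ := top_le_iff.mp (h ▸ H.normalCore_le)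
    simp [this] at hH
  have hrange : φ.range = alternatingGroup (alternatingGroup (Fin 5) ⧸ H) := by
    apply Equiv.Perm.eq_alternatingGroup_of_index_eq_two
    have h1 := φ.range.index_mul_card
    have h2 := two_mul_nat_card_alternatingGroup (α := Fin 5)
    rw [Nat.card_perm, Nat.card_fin] at h2
    rw [← Nat.card_congr (φ.ofInjective ((MonoidHom.ker_eq_bot_iff φ).mp hker)).toEquiv,
      Nat.card_perm, hcard, ← h2] at h1
    exact Nat.eq_of_mul_eq_mul_right Nat.card_pos h1
  have := alternatingGroup.isMultiplyPretransitive (alternatingGroup (Fin 5) ⧸ H)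
  have h2 : IsMultiplyPretransitive (alternatingGroup (alternatingGroup (Fin 5) ⧸ H))
      (alternatingGroup (Fin 5) ⧸ H) 2 :=
    isMultiplyPretransitive_of_le (n := Nat.card (alternatingGroup (Fin 5) ⧸ H) - 2)
      (by omega) (by omega)
  rw [is_two_pretransitive_iff] at h2 ⊢
  intro a b c d hab hcd
  obtain ⟨⟨σ, hσ⟩, hσa, hσb⟩ := h2 hab hcd
  obtain ⟨g, rfl⟩ := hrange ▸ hσ
  exact ⟨g, hσa, hσb⟩

theorem stmt_7 (p : ℕ) [Fact p.Prime] (hp : 5 < p)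
    (V : Type*) [AddCommGroup V] [Module (ZMod p) V]
    [Nontrivial V] [FiniteDimensional (ZMod p) V]
    (ρ : (alternatingGroup (Fin 5)) →* (V →ₗ[ZMod p] V)ˣ)
    -- ρ is faithful
    (hfaithful : Function.Injective ρ)
    -- ρ is irreducible: the only invariant subspaces are 0 and V
    (hirr : ∀ W : Submodule (ZMod p) V,
      (∀ (g : (alternatingGroup (Fin 5))), ∀ w ∈ W, (ρ g : V →ₗ[ZMod p] V) w ∈ W) →
      W = ⊥ ∨ W = ⊤)
    -- H is a subgroup of Alt(5) of index 5
    (H : Subgroup ((alternatingGroup (Fin 5)))) (hH : H.index = 5)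
    -- some nonzero vector is fixed by every element of H
    (x : V) (hx : x ≠ 0) (hfix : ∀ h ∈ H, (ρ h : V →ₗ[ZMod p] V) x = x) :
    Module.finrank (ZMod p) V = 4 := by
  have hcard : Nat.card (alternatingGroup (Fin 5)) = 60 := by
    have := two_mul_nat_card_alternatingGroup (α := Fin 5)
    rw [Nat.card_perm, Nat.card_fin, show Nat.factorial 5 = 2 * 60 from rfl] at this
    exact Nat.eq_of_mul_eq_mul_left two_pos this
  have hcard_ne : (Nat.card (alternatingGroup (Fin 5)) : ZMod p) ≠ 0 := by
    have hpp : p.Prime := Fact.out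
    rw [Ne, ZMod.natCast_eq_zero_iff, hcard]
    intro h
    have h120 : p ∣ Nat.factorial 5 := h.trans (by decide)
    exact absurd (hpp.dvd_factorial.mp h120) (by omega)
  have := isMultiplyPretransitive_quotient H hH
  have := finrank_add_one_eq_index hcard_ne ρ hfaithful hirr H x hx hfix
  omega
end

section
/- Let p be an odd prime. Then PSL(2,p) has a maximal subgroup isomorphic to the alternating group Alt(5) if and only if p ≡ 1 or −1 (mod 10); moreover, in that case the maximal subgroups of PSL(2,p) isomorphic to Alt(5) form exactly two conjugacy classes. -/
/-- The projective special linear group PSL(2,F): the quotient of SL(2,F) by its center. -/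
abbrev PSL2 (F : Type*) [Field F] :=
  Matrix.SpecialLinearGroup (Fin 2) F ⧸ Subgroup.center (Matrix.SpecialLinearGroup (Fin 2) F)

/-- `M` is a maximal subgroup of `PSL(2,p)` isomorphic to `Alt(5)`. -/
def IsMaxAlt5 (p : ℕ) [Fact p.Prime] (M : Subgroup (PSL2 (ZMod p))) : Prop :=
  IsCoatom M ∧ Nonempty (M ≃* alternatingGroup (Fin 5))

/-- Two subgroups are conjugate. -/
def AreConj {G : Type*} [Group G] (M N : Subgroup G) : Prop :=
  ∃ g : G, Subgroup.map (MulAut.conj g).toMonoidHom M = N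

section Icosahedral

variable {G : Type*} [Group G]

/-- The relations of the `(2,3,5)` triangle group. -/
structure IcoRel (a b : G) : Prop where
  sq : a ^ 2 = 1
  cube : b ^ 3 = 1
  fifth : (a * b) ^ 5 = 1

/-- The sixty normal forms of the `(2,3,5)` triangle group. -/
def icoList (a b : G) : List G :=
    [1, a * 1, b * 1, b⁻¹ * 1, a * (b * 1), a * (b⁻¹ * 1), b * (a * 1), b⁻¹ * (a * 1), a * (b *
    (a * 1)), a * (b⁻¹ * (a * 1)), b * (a * (b * 1)), b * (a * (b⁻¹ * 1)), b⁻¹ * (a * (b * 1)),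
    b⁻¹ * (a * (b⁻¹ * 1)), a * (b * (a * (b * 1))), a * (b * (a * (b⁻¹ * 1))), a * (b⁻¹ * (a *
    (b * 1))), a * (b⁻¹ * (a * (b⁻¹ * 1))), b * (a * (b * (a * 1))), b * (a * (b⁻¹ * (a * 1))),
    b⁻¹ * (a * (b * (a * 1))), b⁻¹ * (a * (b⁻¹ * (a * 1))), a * (b * (a * (b⁻¹ * (a * 1)))), a *
    (b⁻¹ * (a * (b * (a * 1)))), a * (b⁻¹ * (a * (b⁻¹ * (a * 1)))), b * (a * (b * (a * (b⁻¹ *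
    1)))), b * (a * (b⁻¹ * (a * (b * 1)))), b * (a * (b⁻¹ * (a * (b⁻¹ * 1)))), b⁻¹ * (a * (b *
    (a * (b * 1)))), b⁻¹ * (a * (b * (a * (b⁻¹ * 1)))), b⁻¹ * (a * (b⁻¹ * (a * (b * 1)))), b⁻¹ *
    (a * (b⁻¹ * (a * (b⁻¹ * 1)))), a * (b * (a * (b⁻¹ * (a * (b * 1))))), a * (b * (a * (b⁻¹ *
    (a * (b⁻¹ * 1))))), a * (b⁻¹ * (a * (b * (a * (b * 1))))), a * (b⁻¹ * (a * (b * (a * (b⁻¹ *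
    1))))), b * (a * (b * (a * (b⁻¹ * (a * 1))))), b * (a * (b⁻¹ * (a * (b * (a * 1))))), b⁻¹ *
    (a * (b * (a * (b⁻¹ * (a * 1))))), b⁻¹ * (a * (b⁻¹ * (a * (b * (a * 1))))), a * (b * (a *
    (b⁻¹ * (a * (b * (a * 1)))))), a * (b⁻¹ * (a * (b * (a * (b⁻¹ * (a * 1)))))), b * (a * (b *
    (a * (b⁻¹ * (a * (b * 1)))))), b * (a * (b * (a * (b⁻¹ * (a * (b⁻¹ * 1)))))), b * (a * (b⁻¹
    * (a * (b * (a * (b * 1)))))), b * (a * (b⁻¹ * (a * (b * (a * (b⁻¹ * 1)))))), b⁻¹ * (a * (b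
    * (a * (b⁻¹ * (a * (b * 1)))))), b⁻¹ * (a * (b * (a * (b⁻¹ * (a * (b⁻¹ * 1)))))), b⁻¹ * (a *
    (b⁻¹ * (a * (b * (a * (b * 1)))))), b⁻¹ * (a * (b⁻¹ * (a * (b * (a * (b⁻¹ * 1)))))), a * (b
    * (a * (b⁻¹ * (a * (b * (a * (b⁻¹ * 1))))))), a * (b⁻¹ * (a * (b * (a * (b⁻¹ * (a * (b *
    1))))))), a * (b⁻¹ * (a * (b * (a * (b⁻¹ * (a * (b⁻¹ * 1))))))), b * (a * (b⁻¹ * (a * (b *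
    (a * (b⁻¹ * (a * 1))))))), b⁻¹ * (a * (b * (a * (b⁻¹ * (a * (b * (a * 1))))))), b⁻¹ * (a *
    (b⁻¹ * (a * (b * (a * (b⁻¹ * (a * 1))))))), a * (b * (a * (b⁻¹ * (a * (b * (a * (b⁻¹ * (a *
    1)))))))), a * (b⁻¹ * (a * (b * (a * (b⁻¹ * (a * (b * (a * 1)))))))), b⁻¹ * (a * (b * (a *
    (b⁻¹ * (a * (b * (a * (b⁻¹ * 1)))))))), b⁻¹ * (a * (b * (a * (b⁻¹ * (a * (b * (a * (b⁻¹ * (a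
    * 1)))))))))]

set_option linter.unusedSimpArgs false in
/-- The sixty normal forms are stable under left multiplication by the generators; the proof
derives a complete rewriting system from the relations. -/
theorem IcoRel.mul_mem_icoList {a b : G} (h : IcoRel a b) :
    (∀ x ∈ icoList a b, a * x ∈ icoList a b) ∧ ∀ x ∈ icoList a b, b * x ∈ icoList a b := by
  have ha : ∀ t : G, a * (a * t) = t := fun t => by
    rw [← mul_assoc, ← pow_two, h.sq, one_mul]
  have hb : ∀ t : G, b * (b * t) = b⁻¹ * t := fun t => by
    rw [← mul_assoc, ← pow_two]
    exact congrArg (· * t) (eq_inv_of_mul_eq_one_left (by rw [← pow_succ, h.cube]))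
  have hb' : ∀ t : G, b⁻¹ * (b⁻¹ * t) = b * t := fun t => by
    rw [← hb, mul_inv_cancel_left]
  have r0 : ∀ t : G, a * (b * (a * (b * (a * t)))) = b⁻¹ * (a * (b⁻¹ * (a * (b⁻¹ * t)))) := fun t => by
    have ha : a⁻¹ = a := inv_eq_of_mul_eq_one_left (by rw [← pow_two, h.sq])
    have h5 := h.fifth
    have h6 : a * b * (a * b) * a = (b * (a * b) * (a * b))⁻¹ := by
      apply eq_inv_of_mul_eq_one_left
      rw [← h5]
      simp only [pow_succ, pow_zero, one_mul, mul_assoc]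
    simp only [mul_inv_rev, ha] at h6
    have h7 := congrArg (· * t) h6
    simpa only [mul_assoc] using h7
  have r1 : ∀ t : G, a * (b⁻¹ * (a * (b⁻¹ * (a * (b⁻¹ * t))))) =
      b * (a * (b * (a * t))) := fun t => by
    have h := (ha (b * (a * (b * (a * t))))).symm.trans
      (congrArg (fun s => a * s) (r0 t))
    exact h.symm
  have r2 : ∀ t : G, b⁻¹ * (a * (b⁻¹ * (a * (b⁻¹ * (a * t))))) =
      a * (b * (a * (b * t))) := fun t => by
    have h := (r0 (a * t)).symm.trans
      (congrArg (fun s => a * (b * (a * (b * s)))) (ha t))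
    exact h
  have r3 : ∀ t : G, b * (a * (b * (a * (b * t)))) =
      a * (b⁻¹ * (a * (b⁻¹ * (a * t)))) := fun t => by
    have h := (mul_inv_cancel_left b (a * (b⁻¹ * (a * (b⁻¹ * (a * t)))))).symm.trans
      (congrArg (fun s => b * s) (r2 t))
    exact h.symm
  have r4 : ∀ t : G, b * (a * (b⁻¹ * (a * (b⁻¹ * (a * t))))) =
      b⁻¹ * (a * (b * (a * (b * t)))) := fun t => by
    have h := (hb (a * (b * (a * (b * t))))).symm.trans
      (congrArg (fun s => b * s) (r3 t))
    exact h.symm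
  have r5 : ∀ t : G, a * (b⁻¹ * (a * (b⁻¹ * (a * (b * t))))) =
      b * (a * (b * (a * (b⁻¹ * t)))) := fun t => by
    have h := (r3 (b * t)).symm.trans
      (congrArg (fun s => b * (a * (b * (a * s)))) (hb t))
    exact h
  have r6 : ∀ t : G, b⁻¹ * (a * (b⁻¹ * (a * (b * (a * (b⁻¹ * (a * (b⁻¹ * t)))))))) =
      a * (b * (a * (b⁻¹ * (a * (b * (a * t)))))) := fun t => by
    have h := (r0 (b⁻¹ * (a * (b⁻¹ * (a * (b⁻¹ * t)))))).symm.trans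
      (congrArg (fun s => a * (b * (a * (b * s)))) (r1 t))
    simp only [hb', hb] at h
    exact h
  have r7 : ∀ t : G, b * (a * (b * (a * (b⁻¹ * (a * (b * (a * t))))))) =
      a * (b⁻¹ * (a * (b * (a * (b⁻¹ * (a * (b⁻¹ * t))))))) := fun t => by
    have h := (mul_inv_cancel_left b (a * (b⁻¹ * (a * (b * (a * (b⁻¹ * (a * (b⁻¹ * t))))))))).symm.trans
      (congrArg (fun s => b * s) (r6 t))
    exact h.symm
  have r8 : ∀ t : G, b * (a * (b⁻¹ * (a * (b * (a * (b⁻¹ * (a * (b⁻¹ * t)))))))) =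
      b⁻¹ * (a * (b * (a * (b⁻¹ * (a * (b * (a * t))))))) := fun t => by
    have h := (hb (a * (b * (a * (b⁻¹ * (a * (b * (a * t)))))))).symm.trans
      (congrArg (fun s => b * s) (r7 t))
    exact h.symm
  have r9 : ∀ t : G, a * (b * (a * (b⁻¹ * (a * (b * (a * (b * t))))))) =
      b⁻¹ * (a * (b⁻¹ * (a * (b * (a * (b⁻¹ * (a * t))))))) := fun t => by
    have h := (r0 (b⁻¹ * (a * (b⁻¹ * (a * t))))).symm.trans
      (congrArg (fun s => a * (b * (a * s))) (r4 t))
    simp only [hb'] at h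
    exact h.symm
  have r10 : ∀ t : G, b⁻¹ * (a * (b⁻¹ * (a * (b * (a * (b⁻¹ * (a * (b * t)))))))) =
      a * (b * (a * (b⁻¹ * (a * (b * (a * (b⁻¹ * t))))))) := fun t => by
    have h := (r9 (b * t)).symm.trans
      (congrArg (fun s => a * (b * (a * (b⁻¹ * (a * (b * (a * s))))))) (hb t))
    exact h
  have r11 : ∀ t : G, b * (a * (b⁻¹ * (a * (b * (a * (b⁻¹ * (a * (b * t)))))))) =
      b⁻¹ * (a * (b * (a * (b⁻¹ * (a * (b * (a * (b⁻¹ * t)))))))) := fun t => by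
    have h := (hb' (a * (b⁻¹ * (a * (b * (a * (b⁻¹ * (a * (b * t))))))))).symm.trans
      (congrArg (fun s => b⁻¹ * s) (r10 t))
    exact h
  have r12 : ∀ t : G, a * (b⁻¹ * (a * (b * (a * (b⁻¹ * (a * (b * (a * (b⁻¹ * (a * t)))))))))) =
      b⁻¹ * (a * (b * (a * (b⁻¹ * (a * (b * (a * (b⁻¹ * t)))))))) := fun t => by
    have h := (r0 (b⁻¹ * (a * (b * (a * (b⁻¹ * (a * (b⁻¹ * t)))))))).symm.trans
      (congrArg (fun s => a * (b * (a * s))) (r8 t))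
    simp only [hb', r0, r11] at h
    exact h.symm
  have r13 : ∀ t : G, a * (b⁻¹ * (a * (b * (a * (b⁻¹ * (a * (b * (a * (b⁻¹ * t))))))))) =
      b⁻¹ * (a * (b * (a * (b⁻¹ * (a * (b * (a * (b⁻¹ * (a * t))))))))) := fun t => by
    have h := (ha (b⁻¹ * (a * (b * (a * (b⁻¹ * (a * (b * (a * (b⁻¹ * (a * t))))))))))).symm.trans
      (congrArg (fun s => a * s) (r12 t))
    exact h.symm
  constructor <;>
  simp only [icoList, List.mem_cons, forall_eq_or_imp, List.not_mem_nil, false_imp_iff, implies_true,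
    ha, hb, hb', mul_inv_cancel_left, inv_mul_cancel_left, r0, r1, r2, r3, r4, r5, r6, r7, r8,
    r9, r10, r11, r13,
    true_or, or_true, and_self]

/-- The involution `(0 1)(2 3)` of `Alt(5)`. -/
def icoA : alternatingGroup (Fin 5) :=
  ⟨Equiv.swap 0 1 * Equiv.swap 2 3, Equiv.Perm.mem_alternatingGroup.mpr (by decide)⟩

/-- The three-cycle `(1 2 4)` of `Alt(5)`. -/
def icoB : alternatingGroup (Fin 5) :=
  ⟨Equiv.swap 1 2 * Equiv.swap 2 4, Equiv.Perm.mem_alternatingGroup.mpr (by decide)⟩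

/-- The three-cycle `(0 2 4)` of `Alt(5)`. -/
def icoB' : alternatingGroup (Fin 5) :=
  ⟨Equiv.swap 0 2 * Equiv.swap 2 4, Equiv.Perm.mem_alternatingGroup.mpr (by decide)⟩

theorem icoRel_icoB : IcoRel icoA icoB := by
  constructor <;> decide

theorem icoRel_icoB' : IcoRel icoA icoB' := by
  constructor <;> decide

theorem exists_conj_sq_eq :
    ∃ k : alternatingGroup (Fin 5), k * ((icoA * icoB) * (icoA * icoB)) * k⁻¹ = icoA * icoB' :=
  ⟨⟨Equiv.swap 0 4 * Equiv.swap 1 3, Equiv.Perm.mem_alternatingGroup.mpr (by decide)⟩, by decide⟩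

theorem mem_icoList (x : alternatingGroup (Fin 5)) : x ∈ icoList icoA icoB := by
  have h : (icoList icoA icoB).Nodup := by decide +kernel
  have hc : (icoList icoA icoB).toFinset = Finset.univ := by
    apply Finset.eq_univ_of_card
    rw [List.toFinset_card_of_nodup h, card_alternatingGroup]
    rfl
  exact List.mem_toFinset.mp (hc ▸ Finset.mem_univ x)

theorem forall_eq_one_or_conj_icoA :
    ∀ x ∈ icoList icoA icoB, x * x = 1 → x = 1 ∨
      ∃ g ∈ icoList icoA icoB, g * x * g⁻¹ = icoA := by
  decide +kernel

theorem forall_conj_icoB :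
    ∀ y ∈ icoList icoA icoB, y * y * y = 1 → (icoA * y) ^ 5 = 1 → y = 1 ∨ icoA * y = 1 ∨
      ∃ g ∈ icoList icoA icoB, g * icoA * g⁻¹ = icoA ∧
        (g * y * g⁻¹ = icoB ∨ g * y * g⁻¹ = icoB') := by
  decide +kernel

theorem exists_conj_eq_icoA_icoB {x y : alternatingGroup (Fin 5)} (h : IcoRel x y) (hx : x ≠ 1)
    (hy : y ≠ 1) (hxy : x * y ≠ 1) :
    ∃ g, g * x * g⁻¹ = icoA ∧ (g * y * g⁻¹ = icoB ∨ g * y * g⁻¹ = icoB') := by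
  obtain hx' | ⟨g, -, hg⟩ := forall_eq_one_or_conj_icoA x (mem_icoList x) (by rw [← pow_two, h.sq])
  · exact absurd hx' hx
  have hmul : icoA * (g * y * g⁻¹) = g * (x * y) * g⁻¹ := by rw [← hg]; group
  obtain hy' | hxy' | ⟨k, -, hk, hk'⟩ := forall_conj_icoB (g * y * g⁻¹) (mem_icoList _)
    (by rw [← pow_two, ← pow_succ, conj_pow, h.cube]; simp)
    (by rw [hmul, conj_pow, h.fifth]; simp)
  · exact absurd (conj_eq_one_iff.mp hy') hy
  · exact absurd (conj_eq_one_iff.mp (hmul ▸ hxy')) hxy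
  · refine ⟨k * g, by rw [← hk, ← hg]; group, ?_⟩
    have e : k * g * y * (k * g)⁻¹ = k * (g * y * g⁻¹) * k⁻¹ := by group
    rwa [e]

theorem IcoRel.mem_icoList_of_mem_closure {a b : G} (h : IcoRel a b) {x : G}
    (hx : x ∈ Subgroup.closure {a, b}) : x ∈ icoList a b := by
  have ha : a⁻¹ = a := inv_eq_of_mul_eq_one_left (by rw [← pow_two, h.sq])
  have hb : b⁻¹ = b * b := inv_eq_of_mul_eq_one_left (by rw [← pow_two, ← pow_succ, h.cube])
  induction hx using Subgroup.closure_induction_left with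
  | one => simp [icoList]
  | mul_left s hs y _ hy =>
    rcases hs with rfl | rfl
    · exact h.mul_mem_icoList.1 _ hy
    · exact h.mul_mem_icoList.2 _ hy
  | inv_mul_cancel s hs y _ hy =>
    rcases hs with rfl | rfl
    · rw [ha]
      exact h.mul_mem_icoList.1 _ hy
    · rw [hb, mul_assoc]
      exact h.mul_mem_icoList.2 _ (h.mul_mem_icoList.2 _ hy)

theorem closure_icoA_icoB : Subgroup.closure {icoA, icoB} = ⊤ := by
  rw [eq_top_iff]
  rintro x -
  have ha : icoA ∈ Subgroup.closure {icoA, icoB} := Subgroup.subset_closure (by simp)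
  have hb : icoB ∈ Subgroup.closure {icoA, icoB} := Subgroup.subset_closure (by simp)
  have key : ∀ y ∈ icoList icoA icoB, y ∈ Subgroup.closure {icoA, icoB} := by
    simp only [icoList, List.mem_cons, forall_eq_or_imp, List.not_mem_nil, false_imp_iff,
      implies_true, Subgroup.mul_mem_cancel_left _ ha, Subgroup.mul_mem_cancel_left _ hb,
      Subgroup.mul_mem_cancel_left _ (inv_mem hb), one_mem, and_self]
  exact key x (mem_icoList x)

theorem icoHom_ext {f g : alternatingGroup (Fin 5) →* G} (hA : f icoA = g icoA)
    (hB : f icoB = g icoB) : f = g := by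
  refine MonoidHom.eq_of_eqOn_dense closure_icoA_icoB ?_
  rintro x (rfl | rfl)
  exacts [hA, hB]

theorem forall_icoList_prod {a b : G} :
    ∀ x ∈ icoList ((a, icoA) : G × alternatingGroup (Fin 5)) (b, icoB), x.2 = 1 → x = 1 := by
  have h : ∀ x ∈ (icoList icoA icoB).tail, x ≠ 1 := by decide +kernel
  have e : icoList ((a, icoA) : G × alternatingGroup (Fin 5)) (b, icoB) =
    1 :: (icoList ((a, icoA) : G × alternatingGroup (Fin 5)) (b, icoB)).tail := rfl
  have e' : (icoList ((a, icoA) : G × alternatingGroup (Fin 5)) (b, icoB)).tail.map Prod.snd =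
    (icoList icoA icoB).tail := rfl
  intro x hx hx2
  rw [e, List.mem_cons] at hx
  refine hx.resolve_right fun hx => h x.2 ?_ hx2
  rw [← e']
  exact List.mem_map_of_mem hx

/-- `Alt(5)` is presented by the relations of the `(2,3,5)` triangle group. -/
theorem IcoRel.exists_hom {a b : G} (h : IcoRel a b) :
    ∃ f : alternatingGroup (Fin 5) →* G, f icoA = a ∧ f icoB = b := by
  have hp : IcoRel ((a, icoA) : G × alternatingGroup (Fin 5)) (b, icoB) :=
    ⟨Prod.ext h.sq icoRel_icoB.sq, Prod.ext h.cube icoRel_icoB.cube,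
      Prod.ext h.fifth icoRel_icoB.fifth⟩
  set K : Subgroup (G × alternatingGroup (Fin 5)) := Subgroup.closure {(a, icoA), (b, icoB)} with hK
  let π : K →* alternatingGroup (Fin 5) := (MonoidHom.snd _ _).comp K.subtype
  have hinj : Function.Injective π := by
    rw [injective_iff_map_eq_one]
    intro x hx
    exact Subtype.ext (forall_icoList_prod _ (hp.mem_icoList_of_mem_closure x.2) hx)
  have hA : (a, icoA) ∈ K := Subgroup.subset_closure (by simp)
  have hB : (b, icoB) ∈ K := Subgroup.subset_closure (by simp)
  have hsurj : Function.Surjective π := by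
    rw [← MonoidHom.range_eq_top, eq_top_iff, ← closure_icoA_icoB, Subgroup.closure_le]
    rintro x (rfl | rfl)
    exacts [⟨⟨_, hA⟩, rfl⟩, ⟨⟨_, hB⟩, rfl⟩]
  let e := MulEquiv.ofBijective π ⟨hinj, hsurj⟩
  refine ⟨((MonoidHom.fst _ _).comp K.subtype).comp e.symm.toMonoidHom, ?_, ?_⟩
  · have : e.symm icoA = ⟨_, hA⟩ := e.symm_apply_eq.mpr rfl
    simp [this]
  · have : e.symm icoB = ⟨_, hB⟩ := e.symm_apply_eq.mpr rfl
    simp [this]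

theorem icoHom_injective {f : alternatingGroup (Fin 5) →* G} (h : f icoA ≠ 1) :
    Function.Injective f := by
  have : IsSimpleGroup (alternatingGroup (Fin 5)) := alternatingGroup.isSimpleGroup (by simp)
  rw [← MonoidHom.ker_eq_bot_iff]
  refine f.normal_ker.eq_bot_or_eq_top.resolve_right fun h' => h ?_
  exact MonoidHom.mem_ker.mp (h' ▸ Subgroup.mem_top _)

/-- An automorphism of `Alt(5)` exchanging the two classes of elements of order five. -/
theorem exists_outer_hom : ∃ f : alternatingGroup (Fin 5) →* alternatingGroup (Fin 5),
    Function.Bijective f ∧ f icoA = icoA ∧ f icoB = icoB' := by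
  obtain ⟨f, hA, hB⟩ := icoRel_icoB'.exists_hom
  refine ⟨f, Finite.injective_iff_bijective.mp (icoHom_injective ?_), hA, hB⟩
  rw [hA]
  decide

end Icosahedral

section Burnside

private theorem icosahedral_bound_aux {N n₁ n₂ n₃ s₁ s₂ s₃ : ℕ} (h₁ : n₁ * s₁ = N)
    (h₂ : n₂ * s₂ = N) (h₃ : n₃ * s₃ = N) (h₂₁ : s₂ ≤ s₁) (h₃₂ : s₃ ≤ s₂) (hs : 3 ≤ s₃)
    (hlt : s₁ < N) (hsum : s₁ + s₂ + s₃ = N + 2) : N ≤ 60 := by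
  by_contra! hN
  have hn₁ : n₁ = 2 := by
    have : n₁ < 3 := by by_contra! h; nlinarith
    interval_cases n₁ <;> omega
  subst hn₁
  have hn₂ : n₂ = 3 := by
    have : n₂ < 4 := by by_contra! h; nlinarith
    interval_cases n₂ <;> omega
  subst hn₂
  have hn₃ : n₃ < 6 := by by_contra! h; nlinarith
  interval_cases n₃ <;> omega

private theorem icosahedral_bound {N s₁ s₂ s₃ : ℕ} (h₁ : s₁ ∣ N) (h₂ : s₂ ∣ N) (h₃ : s₃ ∣ N)
    (hs₁ : 3 ≤ s₁) (hs₂ : 3 ≤ s₂) (hs₃ : 3 ≤ s₃) (hlt₁ : s₁ < N) (hlt₂ : s₂ < N) (hlt₃ : s₃ < N)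
    (hsum : s₁ + s₂ + s₃ = N + 2) : N ≤ 60 := by
  obtain ⟨n₁, e₁⟩ := exists_eq_mul_left_of_dvd h₁
  obtain ⟨n₂, e₂⟩ := exists_eq_mul_left_of_dvd h₂
  obtain ⟨n₃, e₃⟩ := exists_eq_mul_left_of_dvd h₃
  rcases le_total s₁ s₂ with a | a <;> rcases le_total s₂ s₃ with b | b <;>
    rcases le_total s₁ s₃ with c | c
  · exact icosahedral_bound_aux e₃.symm e₂.symm e₁.symm b a hs₁ hlt₃ (by omega)
  · exact icosahedral_bound_aux e₃.symm e₂.symm e₁.symm b a hs₁ hlt₃ (by omega)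
  · exact icosahedral_bound_aux e₂.symm e₃.symm e₁.symm b c hs₁ hlt₂ (by omega)
  · exact icosahedral_bound_aux e₂.symm e₁.symm e₃.symm a c hs₃ hlt₂ (by omega)
  · exact icosahedral_bound_aux e₃.symm e₁.symm e₂.symm c a hs₂ hlt₃ (by omega)
  · exact icosahedral_bound_aux e₁.symm e₃.symm e₂.symm c b hs₂ hlt₁ (by omega)
  · exact icosahedral_bound_aux e₁.symm e₂.symm e₃.symm a b hs₃ hlt₁ (by omega)
  · exact icosahedral_bound_aux e₁.symm e₂.symm e₃.symm a b hs₃ hlt₁ (by omega)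

/-- A finite group of order greater than `60` all of whose nontrivial elements have exactly two
fixed points has a point stabilizer of index at most two. -/
theorem exists_index_stabilizer_le_two {G X : Type*} [Group G] [Finite G] [Finite X]
    [MulAction G X] (hfix : ∀ g : G, g ≠ 1 → Nat.card (MulAction.fixedBy X g) = 2)
    (hG : 60 < Nat.card G) : ∃ x : X, (MulAction.stabilizer G x).index ≤ 2 := by
  classical
  have := Fintype.ofFinite G
  have := Fintype.ofFinite X
  have := Fintype.ofFinite (Quotient (MulAction.orbitRel G X))
  by_contra! hidx
  set N := Nat.card G with hN
  let s : Quotient (MulAction.orbitRel G X) → ℕ := fun ω => Nat.card (MulAction.orbitRel.Quotient.orbit ω)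
  have hs : ∀ ω, s ω ∣ N ∧ 3 ≤ s ω := by
    intro ω
    induction ω using Quotient.inductionOn' with | h x =>
    have e : s (Quotient.mk'' x) = (MulAction.stabilizer G x).index := by
      rw [MulAction.index_stabilizer]
      rfl
    rw [e]
    exact ⟨Subgroup.index_dvd_card _, hidx x⟩
  have hX : ∑ ω, s ω = Nat.card X := by
    rw [Nat.card_congr (MulAction.selfEquivSigmaOrbits' G X), Nat.card_sigma]
  have hB : ∑ g : G, Nat.card (MulAction.fixedBy X g) =
      Fintype.card (Quotient (MulAction.orbitRel G X)) * N := by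
    have := MulAction.sum_card_fixedBy_eq_card_orbits_mul_card_group G X
    simpa only [← Nat.card_eq_fintype_card] using this
  have hsum : ∑ g : G, Nat.card (MulAction.fixedBy X g) = Nat.card X + (N - 1) * 2 := by
    rw [← Finset.add_sum_erase _ _ (Finset.mem_univ (1 : G)), Finset.sum_const_nat (m := 2)]
    · rw [Finset.card_erase_of_mem (Finset.mem_univ _), Finset.card_univ,
        MulAction.fixedBy_one_eq_univ, hN, Nat.card_eq_fintype_card]
      simp
    · intro g hg
      exact hfix g (Finset.ne_of_mem_erase hg)
  have hle : ∀ ω, s ω ≤ N := fun ω => Nat.le_of_dvd (by omega) (hs ω).1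
  have hdef : ∑ ω, (N - s ω) = 2 * N - 2 := by
    rw [Finset.sum_tsub_distrib _ fun ω _ => hle ω, Finset.sum_const, Finset.card_univ, smul_eq_mul]
    omega
  set T := Finset.univ.filter fun ω => s ω < N with hT
  have hdefT : ∑ ω ∈ T, (N - s ω) = 2 * N - 2 := by
    rw [← hdef, hT, Finset.sum_filter]
    refine Finset.sum_congr rfl fun ω _ => ?_
    split_ifs with h
    · rfl
    · omega
  have hhalf : ∀ ω ∈ T, N ≤ 2 * (N - s ω) := by
    intro ω hω
    have hlt : s ω < N := (Finset.mem_filter.mp hω).2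
    obtain ⟨k, hk⟩ := (hs ω).1
    have : 2 ≤ k := by
      by_contra! h
      interval_cases k <;> omega
    have : s ω * 2 ≤ N := hk ▸ Nat.mul_le_mul_left _ this
    omega
  have hcard : T.card ≤ 3 := by
    have h := Finset.card_nsmul_le_sum T (fun ω => 2 * (N - s ω)) N hhalf
    rw [← Finset.mul_sum, hdefT, smul_eq_mul] at h
    by_contra! h'
    have : 4 * N ≤ T.card * N := Nat.mul_le_mul_right _ h'
    omega
  have hcard' : 3 ≤ T.card := by
    have h := Finset.sum_le_card_nsmul T (fun ω => N - s ω) (N - 3) fun ω _ => by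
      have := (hs ω).2
      omega
    rw [hdefT, smul_eq_mul] at h
    by_contra! h'
    have : T.card * (N - 3) ≤ 2 * (N - 3) := Nat.mul_le_mul_right _ (by omega)
    omega
  obtain ⟨x, y, z, hxy, hxz, hyz, hTeq⟩ := Finset.card_eq_three.mp (le_antisymm hcard hcard')
  rw [hTeq] at hdefT
  rw [Finset.sum_insert (by simp [hxy, hxz]), Finset.sum_insert (by simp [hyz]),
    Finset.sum_singleton] at hdefT
  have hlt : ∀ ω ∈ T, s ω < N := fun ω hω => (Finset.mem_filter.mp hω).2
  have hx := hlt x (by simp [hTeq])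
  have hy := hlt y (by simp [hTeq])
  have hz := hlt z (by simp [hTeq])
  have := icosahedral_bound (hs x).1 (hs y).1 (hs z).1 (hs x).2 (hs y).2 (hs z).2 hx hy hz
    (by omega)
  omega

end Burnside

section Trace

open Matrix
open scoped MatrixGroups

variable {F : Type*} [Field F]

theorem mem_center_SL_two_iff {X : SL(2, F)} :
    X ∈ Subgroup.center SL(2, F) ↔ X = 1 ∨ X = -1 := by
  rw [Matrix.SpecialLinearGroup.mem_center_iff]
  constructor
  · rintro ⟨r, hr, h⟩
    rw [Fintype.card_fin] at hr
    refine (mul_self_eq_one_iff.mp ((pow_two r).symm.trans hr)).imp ?_ ?_ <;> rintro rfl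
    · refine Subtype.ext ?_
      simp [← h]
    · refine Subtype.ext ?_
      rw [← h, map_neg, map_one]
      rfl
  · rintro (rfl | rfl)
    · exact ⟨1, by simp, by simp⟩
    · exact ⟨-1, by simp, by rw [map_neg, map_one]; rfl⟩

theorem PSL2_mk_eq_one_iff {X : SL(2, F)} : (X : PSL2 F) = 1 ↔ X = 1 ∨ X = -1 := by
  rw [QuotientGroup.eq_one_iff, mem_center_SL_two_iff]

theorem PSL2_mk_eq_mk_iff {X Y : SL(2, F)} :
    (X : PSL2 F) = (Y : PSL2 F) ↔ X = Y ∨ X = -Y := by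
  rw [eq_comm, QuotientGroup.eq, mem_center_SL_two_iff, inv_mul_eq_one, inv_mul_eq_iff_eq_mul,
    mul_neg, mul_one, eq_comm]

theorem PSL2_mk_neg (X : SL(2, F)) : ((-X : SL(2, F)) : PSL2 F) = X :=
  PSL2_mk_eq_mk_iff.mpr (Or.inr rfl)

theorem eq_zero_of_smul_eq_smul_one {X : SL(2, F)} (hX : (X : PSL2 F) ≠ 1)
    {α β : F} (h : α • X.1 = β • 1) : α = 0 ∧ β = 0 := by
  have hα : α = 0 := by
    by_contra hα
    refine hX ((QuotientGroup.eq_one_iff _).mpr ?_)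
    have hX' : X.1 = (α⁻¹ * β) • 1 := by
      rw [mul_smul, ← h, inv_smul_smul₀ hα]
    refine Matrix.SpecialLinearGroup.mem_center_iff.mpr ⟨α⁻¹ * β, ?_, ?_⟩
    · have := X.det_coe
      rw [hX'] at this
      simpa using this
    · rw [hX', smul_one_eq_diagonal, scalar_apply]
  refine ⟨hα, ?_⟩
  have := congr_fun₂ h 0 0
  simpa [hα] using this.symm

theorem SL_two_sq_eq (X : SL(2, F)) : X.1 ^ 2 = X.1.trace • X.1 - 1 := by
  have h : X.1 ^ 2 = X.1.trace • X.1 - X.1.det • 1 := by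
    generalize X.1 = M
    ext i j
    fin_cases i <;> fin_cases j <;>
      simp [pow_two, mul_apply, trace_fin_two, det_fin_two, Fin.sum_univ_two] <;> ring
  rw [h, X.2, one_smul]

theorem SL_two_mul_self_eq (X : SL(2, F)) : X.1 * X.1 = X.1.trace • X.1 - 1 := by
  rw [← pow_two, SL_two_sq_eq]

theorem SL_two_cube_eq (X : SL(2, F)) :
    X.1 ^ 3 = (X.1.trace ^ 2 - 1) • X.1 - X.1.trace • 1 := by
  rw [pow_succ, SL_two_sq_eq, sub_mul, smul_mul_assoc, SL_two_mul_self_eq, one_mul]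
  module

theorem SL_two_pow_five_eq (X : SL(2, F)) :
    X.1 ^ 5 = (X.1.trace ^ 4 - 3 * X.1.trace ^ 2 + 1) • X.1
      - (X.1.trace ^ 3 - 2 * X.1.trace) • 1 := by
  rw [show 5 = 3 + 2 from rfl, pow_add, SL_two_sq_eq, SL_two_cube_eq]
  simp only [sub_mul, mul_sub, smul_mul_assoc, mul_smul_comm, SL_two_mul_self_eq, one_mul, mul_one]
  module

theorem PSL2_mk_pow_eq_one_iff {X : SL(2, F)} {n : ℕ} :
    (X : PSL2 F) ^ n = 1 ↔ X.1 ^ n = 1 ∨ X.1 ^ n = -1 := by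
  rw [← QuotientGroup.mk_pow, PSL2_mk_eq_one_iff]
  exact or_congr (by rw [← Matrix.SpecialLinearGroup.coe_pow]; exact Subtype.ext_iff)
    (by rw [← Matrix.SpecialLinearGroup.coe_pow]; exact Subtype.ext_iff)

theorem exists_smul_one_of_mk_pow_eq_one {X : SL(2, F)} {n : ℕ} (h : (X : PSL2 F) ^ n = 1) :
    ∃ β : F, X.1 ^ n = β • 1 := by
  rcases PSL2_mk_pow_eq_one_iff.mp h with h | h
  · exact ⟨1, by simpa using h⟩
  · exact ⟨-1, by simpa using h⟩

theorem trace_eq_zero_of_sq_eq_one {X : SL(2, F)} (hX : (X : PSL2 F) ≠ 1)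
    (h : (X : PSL2 F) ^ 2 = 1) : X.1.trace = 0 := by
  obtain ⟨β, hβ⟩ := exists_smul_one_of_mk_pow_eq_one h
  rw [SL_two_sq_eq, sub_eq_iff_eq_add] at hβ
  refine (eq_zero_of_smul_eq_smul_one (β := β + 1) hX ?_).1
  rw [hβ, add_smul, one_smul]

theorem trace_sq_eq_one_of_cube_eq_one {X : SL(2, F)} (hX : (X : PSL2 F) ≠ 1)
    (h : (X : PSL2 F) ^ 3 = 1) : X.1.trace ^ 2 = 1 := by
  obtain ⟨β, hβ⟩ := exists_smul_one_of_mk_pow_eq_one h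
  rw [SL_two_cube_eq, sub_eq_iff_eq_add, ← add_smul] at hβ
  exact sub_eq_zero.mp (eq_zero_of_smul_eq_smul_one hX hβ).1

theorem trace_of_pow_five_eq_one {X : SL(2, F)} (hX : (X : PSL2 F) ≠ 1)
    (h : (X : PSL2 F) ^ 5 = 1) :
    X.1.trace ^ 2 = X.1.trace + 1 ∨ (-X.1.trace) ^ 2 = -X.1.trace + 1 := by
  obtain ⟨β, hβ⟩ := exists_smul_one_of_mk_pow_eq_one h
  rw [SL_two_pow_five_eq, sub_eq_iff_eq_add, ← add_smul] at hβ
  have h₀ := (eq_zero_of_smul_eq_smul_one hX hβ).1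
  have : (X.1.trace ^ 2 - (X.1.trace + 1)) * ((-X.1.trace) ^ 2 - (-X.1.trace + 1)) = 0 := by
    linear_combination h₀
  exact (mul_eq_zero.mp this).imp sub_eq_zero.mp sub_eq_zero.mp

/-- The pair `(A, B)` satisfies the trace conditions which characterize lifts to `SL(2, F)` of the
standard generators of an icosahedral subgroup of `PSL(2, F)`. -/
structure IcoTrace (γ : F) (A B : SL(2, F)) : Prop where
  trace_left : A.1.trace = 0
  trace_right : B.1.trace = 1
  trace_mul : (A.1 * B.1).trace = γ

theorem mk_ne_one_of_trace_eq_zero (h2 : (2 : F) ≠ 0) {A : SL(2, F)} (hA : A.1.trace = 0) :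
    (A : PSL2 F) ≠ 1 := by
  rw [Ne, PSL2_mk_eq_one_iff]
  rintro (rfl | rfl)
  · simp [h2] at hA
  · simp [trace_neg, h2] at hA

theorem IcoTrace.icoRel {γ : F} (hγ : γ ^ 2 = γ + 1) {A B : SL(2, F)} (h : IcoTrace γ A B) :
    IcoRel (A : PSL2 F) (B : PSL2 F) where
  sq := PSL2_mk_pow_eq_one_iff.mpr <| Or.inr <| by simp [SL_two_sq_eq, h.trace_left]
  cube := PSL2_mk_pow_eq_one_iff.mpr <| Or.inr <| by simp [SL_two_cube_eq, h.trace_right]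
  fifth := by
    rw [← QuotientGroup.mk_mul, PSL2_mk_pow_eq_one_iff]
    right
    have e : (A * B).1.trace = γ := h.trace_mul
    rw [SL_two_pow_five_eq, e, show γ ^ 4 - 3 * γ ^ 2 + 1 = 0 by linear_combination (γ ^ 2 + γ - 1) * hγ,
      show γ ^ 3 - 2 * γ = 1 by linear_combination (γ + 1) * hγ]
    simp

theorem IcoTrace.exists_hom (h2 : (2 : F) ≠ 0) {γ : F} (hγ : γ ^ 2 = γ + 1) {A B : SL(2, F)}
    (h : IcoTrace γ A B) : ∃ f : alternatingGroup (Fin 5) →* PSL2 F,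
      Function.Injective f ∧ f icoA = A ∧ f icoB = B := by
  obtain ⟨f, hA, hB⟩ := (h.icoRel hγ).exists_hom
  exact ⟨f, icoHom_injective (by rw [hA]; exact mk_ne_one_of_trace_eq_zero h2 h.trace_left), hA, hB⟩

theorem exists_trace_lift_of_cube_eq_one {x : PSL2 F} (hx : x ≠ 1) (h : x ^ 3 = 1) :
    ∃ X : SL(2, F), (X : PSL2 F) = x ∧ X.1.trace = 1 := by
  obtain ⟨X, rfl⟩ := QuotientGroup.mk_surjective x
  rcases mul_self_eq_one_iff.mp ((pow_two _).symm.trans (trace_sq_eq_one_of_cube_eq_one hx h)) with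
    h | h
  · exact ⟨X, rfl, h⟩
  · exact ⟨-X, PSL2_mk_neg X, by simp [trace_neg, h]⟩

theorem exists_lift_of_injective {f : alternatingGroup (Fin 5) →* PSL2 F}
    (hf : Function.Injective f) {b : alternatingGroup (Fin 5)} (hb : IcoRel icoA b) (hb1 : b ≠ 1)
    (hab : icoA * b ≠ 1) : ∃ (t : F) (A B : SL(2, F)),
      t ^ 2 = t + 1 ∧ IcoTrace t A B ∧ f icoA = A ∧ f b = B := by
  have hne : ∀ x, x ≠ 1 → f x ≠ 1 := fun x => (map_ne_one_iff f hf).mpr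
  obtain ⟨B, hB, hBt⟩ := exists_trace_lift_of_cube_eq_one (hne b hb1)
    (by rw [← map_pow, hb.cube, map_one])
  obtain ⟨A, hA⟩ := QuotientGroup.mk_surjective (f icoA)
  have hAt : A.1.trace = 0 := trace_eq_zero_of_sq_eq_one (by rw [hA]; exact hne _ (by decide))
    (by rw [hA, ← map_pow, hb.sq, map_one])
  have hAB : ((A * B : SL(2, F)) : PSL2 F) = f (icoA * b) := by
    rw [QuotientGroup.mk_mul, hA, hB, map_mul]
  rcases trace_of_pow_five_eq_one (X := A * B) (by rw [hAB]; exact hne _ hab)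
    (by rw [hAB, ← map_pow, hb.fifth, map_one]) with h | h
  · exact ⟨_, A, B, h, ⟨hAt, hBt, rfl⟩, hA.symm, hB.symm⟩
  · exact ⟨_, -A, B, h, ⟨by simp [trace_neg, hAt], hBt, by simp [trace_neg]⟩,
      by rw [PSL2_mk_neg, hA], hB.symm⟩

theorem trace_conj (X Y : SL(2, F)) : (Y * X * Y⁻¹).1.trace = X.1.trace := by
  have : (Y * X * Y⁻¹).1 = Y.1 * (X * Y⁻¹).1 := by rw [mul_assoc]; rfl
  rw [this, trace_mul_comm]
  change (X * Y⁻¹ * Y).1.trace = _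
  rw [inv_mul_cancel_right]

theorem trace_eq_of_mk_conj {X Y : SL(2, F)} {k : PSL2 F} (h : k * X * k⁻¹ = Y) :
    Y.1.trace = X.1.trace ∨ Y.1.trace = -X.1.trace := by
  obtain ⟨K, rfl⟩ := QuotientGroup.mk_surjective k
  rw [← trace_conj X K]
  rcases PSL2_mk_eq_mk_iff.mp h with h | h
  · exact Or.inl (congrArg (fun Z : SL(2, F) => Z.1.trace) h).symm
  · exact Or.inr (by
      rw [show K * X * K⁻¹ = -Y from h]
      simp [trace_neg])

theorem trace_sq (X : SL(2, F)) : (X * X).1.trace = X.1.trace ^ 2 - 2 := by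
  have : (X * X).1 = X.1.trace • X.1 - 1 := SL_two_mul_self_eq X
  rw [this, trace_sub, trace_smul, trace_one]
  simp [pow_two]

end Trace

section Rigidity

open Matrix
open scoped MatrixGroups

variable {F : Type*} [Field F]

theorem exists_normalized_lift (h2 : (2 : F) ≠ 0) {γ : F} (hγ : γ ^ 2 = γ + 1)
    {f : alternatingGroup (Fin 5) →* PSL2 F} (hf : Function.Injective f) :
    ∃ f' : alternatingGroup (Fin 5) →* PSL2 F, Function.Injective f' ∧ f'.range = f.range ∧
      ∃ A B : SL(2, F), IcoTrace γ A B ∧ f' icoA = A ∧ f' icoB = B := by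
  obtain ⟨t, A, B, ht, h, hA, hB⟩ := exists_lift_of_injective hf icoRel_icoB (by decide) (by decide)
  have htγ : (t - γ) * (t - (1 - γ)) = 0 := by linear_combination ht - hγ
  rcases mul_eq_zero.mp htγ with e | e
  · obtain rfl := sub_eq_zero.mp e
    exact ⟨f, hf, rfl, A, B, h, hA, hB⟩
  rw [sub_eq_zero] at e
  obtain ⟨o, ho, hoA, hoB⟩ := exists_outer_hom
  obtain ⟨t', A', B', ht', h', hA', hB'⟩ :=
    exists_lift_of_injective hf icoRel_icoB' (by decide) (by decide)
  have htt' : t' = γ := by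
    obtain ⟨k, hk⟩ := exists_conj_sq_eq
    have hk' : f k * ((A * B * (A * B) : SL(2, F)) : PSL2 F) * (f k)⁻¹ = (A' * B' : SL(2, F)) := by
      simp only [QuotientGroup.mk_mul, ← hA, ← hB, ← hB', ← hA', ← map_mul, ← map_inv, ← hk]
    have e₁ : (A * B).1.trace = t := h.trace_mul
    have e₂ : (A' * B').1.trace = t' := h'.trace_mul
    have := trace_eq_of_mk_conj hk'
    rw [trace_sq, e₁, e₂] at this
    rcases this with this | this
    · exfalso
      have h0 : t' = -γ := by linear_combination this + ht + e
      have h1 : 2 * γ = 0 := by rw [h0] at ht'; linear_combination ht' - hγ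
      have h3 := (mul_eq_zero.mp h1).resolve_left h2
      simp [h3] at hγ
    · linear_combination this - ht - e
  subst htt'
  refine ⟨f.comp o, hf.comp ho.1, ?_, A', B', h', by simp [hoA, hA'], by simp [hoB, hB']⟩
  rw [MonoidHom.range_comp, MonoidHom.range_eq_top.mpr ho.2, ← MonoidHom.range_eq_map]

/-- The rotation by a quarter turn. -/
def icoMatA (F : Type*) [Field F] : Matrix (Fin 2) (Fin 2) F := !![0, -1; 1, 0]

/-- The general matrix `N` of trace `1` such that `icoMatA F * N` has trace `γ`. -/
def icoMatB (γ x y : F) : Matrix (Fin 2) (Fin 2) F := !![x, y; y - γ, 1 - x]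

theorem eq_icoMatB {γ : F} {N : Matrix (Fin 2) (Fin 2) F} (hN : N.trace = 1)
    (hJN : (icoMatA F * N).trace = γ) : N = icoMatB γ (N 0 0) (N 0 1) := by
  simp only [trace_fin_two, icoMatA, mul_apply, Fin.sum_univ_two] at hN hJN
  simp at hJN
  ext i j
  fin_cases i <;> fin_cases j <;> simp [icoMatB]
  · linear_combination -hJN
  · linear_combination hN

theorem semiconjBy_icoMatA_of_mulVec {A : Matrix (Fin 2) (Fin 2) F} {a b c v w : F}
    (hA : A = !![a, b; c, -a]) (hdet : A.det = 1) :
    SemiconjBy !![v, a * v + b * w; w, c * v - a * w] (icoMatA F) A := by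
  subst hA
  rw [det_fin_two_of] at hdet
  ext i j
  fin_cases i <;> fin_cases j <;> simp [icoMatA, mul_apply, Fin.sum_univ_two] <;>
    first | linear_combination v * hdet | linear_combination w * hdet | ring

theorem exists_semiconjBy_icoMatA (h2 : (2 : F) ≠ 0) {A : SL(2, F)} (hA : A.1.trace = 0) :
    ∃ P : GL (Fin 2) F, SemiconjBy P.1 (icoMatA F) A.1 := by
  have hA' : A.1 = !![A.1 0 0, A.1 0 1; A.1 1 0, -A.1 0 0] := by
    rw [trace_fin_two] at hA
    ext i j
    fin_cases i <;> fin_cases j <;> simp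
    linear_combination hA
  suffices ∃ v w : F, v * (A.1 1 0 * v - A.1 0 0 * w) - (A.1 0 0 * v + A.1 0 1 * w) * w ≠ 0 by
    obtain ⟨v, w, h⟩ := this
    exact ⟨GeneralLinearGroup.mkOfDetNeZero
      !![v, A.1 0 0 * v + A.1 0 1 * w; w, A.1 1 0 * v - A.1 0 0 * w] (by rwa [det_fin_two_of]),
      semiconjBy_icoMatA_of_mulVec hA' A.2⟩
  have hdet := A.det_coe
  rw [hA', det_fin_two_of] at hdet
  by_contra! h
  have h₁ := h 1 0
  have h₂ := h 0 1
  have h₃ := h 1 1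
  simp only [mul_zero, mul_one, one_mul, zero_mul, sub_zero, add_zero, zero_sub, zero_add] at h₁ h₂ h₃
  have h₄ : A.1 0 0 = 0 := by
    refine (mul_eq_zero.mp ?_).resolve_left h2
    linear_combination h₁ + h₂ - h₃
  rw [h₄, h₁] at hdet
  simp at hdet

theorem IcoTrace.exists_normalForm (h2 : (2 : F) ≠ 0) {γ : F} (hγ : γ ^ 2 = γ + 1)
    {A B : SL(2, F)} (h : IcoTrace γ A B) : ∃ (P : GL (Fin 2) F) (x y : F),
      SemiconjBy P.1 (icoMatA F) A.1 ∧ SemiconjBy P.1 (icoMatB γ x y) B.1 ∧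
      (2 * x - 1) ^ 2 + (2 * y - γ) ^ 2 = γ - 2 := by
  obtain ⟨P, hP⟩ := exists_semiconjBy_icoMatA h2 h.trace_left
  set N : Matrix (Fin 2) (Fin 2) F := (P⁻¹).1 * B.1 * P.1 with hN
  have hJ : icoMatA F = (P⁻¹).1 * A.1 * P.1 := by
    rw [mul_assoc, ← hP.eq, ← mul_assoc, Units.inv_mul, one_mul]
  have hPN : SemiconjBy P.1 N B.1 := by
    rw [SemiconjBy, hN, ← mul_assoc, ← mul_assoc, Units.mul_inv, one_mul]
  have htr : N.trace = 1 := by rw [hN, trace_units_conj', h.trace_right]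
  have hdet : N.det = 1 := by rw [hN, det_units_conj', B.2]
  have hJN : (icoMatA F * N).trace = γ := by
    have : icoMatA F * N = (P⁻¹).1 * (A.1 * B.1) * P.1 := by
      rw [hJ, hN]
      simp only [mul_assoc, Units.mul_inv_cancel_left]
    rw [this, trace_units_conj', h.trace_mul]
  have e := eq_icoMatB htr hJN
  refine ⟨P, N 0 0, N 0 1, hP, e ▸ hPN, ?_⟩
  rw [e, icoMatB, det_fin_two_of] at hdet
  linear_combination -4 * hdet + hγ

theorem ne_two_of_sq_eq_add_one {γ : F} (hγ : γ ^ 2 = γ + 1) : γ - 2 ≠ 0 := by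
  intro h
  exact one_ne_zero (α := F) (by linear_combination hγ - (γ + 1) * h)

theorem icoMatB_semiconjBy (h2 : (2 : F) ≠ 0) {γ x y x' y' : F} (hγ : γ - 2 ≠ 0)
    (h : (2 * x - 1) ^ 2 + (2 * y - γ) ^ 2 = γ - 2)
    (h' : (2 * x' - 1) ^ 2 + (2 * y' - γ) ^ 2 = γ - 2) :
    ∃ g : GL (Fin 2) F, SemiconjBy g.1 (icoMatA F) (icoMatA F) ∧
      SemiconjBy g.1 (icoMatB γ x y) (icoMatB γ x' y') := by
  obtain ⟨s, hs⟩ : ∃ s : F, s = γ - 2 + (2 * x - 1) * (2 * x' - 1) + (2 * y - γ) * (2 * y' - γ) :=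
    ⟨_, rfl⟩
  obtain ⟨t, ht⟩ : ∃ t : F, t = (2 * x - 1) * (2 * y' - γ) - (2 * y - γ) * (2 * x' - 1) := ⟨_, rfl⟩
  have hst : s ^ 2 + t ^ 2 = 2 * (γ - 2) * s := by
    rw [hs, ht]
    linear_combination ((2 * x' - 1) ^ 2 + (2 * y' - γ) ^ 2) * h + (γ - 2) * h'
  by_cases hs0 : s = 0
  · have ht0 : t = 0 := by simpa [hs0] using hst
    have hx : 2 * (x + x' - 1) = 0 := by
      refine (mul_eq_zero.mp ?_).resolve_left hγ
      linear_combination (2 * x - 1) * (hs0 - hs) - (2 * y - γ) * (ht0 - ht) - (2 * x' - 1) * h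
    have hy : 2 * (y + y' - γ) = 0 := by
      refine (mul_eq_zero.mp ?_).resolve_left hγ
      linear_combination (2 * y - γ) * (hs0 - hs) + (2 * x - 1) * (ht0 - ht) - (2 * y' - γ) * h
    replace hx := (mul_eq_zero.mp hx).resolve_left h2
    replace hy := (mul_eq_zero.mp hy).resolve_left h2
    refine ⟨GeneralLinearGroup.mkOfDetNeZero (icoMatA F) (by simp [icoMatA]), rfl, ?_⟩
    change icoMatA F * _ = _ * icoMatA F
    obtain rfl : x' = 1 - x := by linear_combination hx
    obtain rfl : y' = γ - y := by linear_combination hy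
    ext i j
    fin_cases i <;> fin_cases j <;> simp [icoMatA, icoMatB, mul_apply, Fin.sum_univ_two]
  · have e₁ : s * (x - x') = t * (y + y' - γ) := by
      refine mul_left_cancel₀ h2 ?_
      rw [hs, ht]
      linear_combination (2 * x' - 1) * h - (2 * x - 1) * h'
    have e₂ : s * (y - y') = -(t * (x + x' - 1)) := by
      refine mul_left_cancel₀ h2 ?_
      rw [hs, ht]
      linear_combination (2 * y' - γ) * h - (2 * y - γ) * h'
    refine ⟨GeneralLinearGroup.mkOfDetNeZero !![s, -t; t, s] ?_, ?_, ?_⟩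
    · rw [det_fin_two_of]
      have : s * s - -t * t = 2 * (γ - 2) * s := by linear_combination hst
      rw [this]
      exact mul_ne_zero (mul_ne_zero h2 hγ) hs0
    · change !![s, -t; t, s] * _ = _ * !![s, -t; t, s]
      ext i j
      fin_cases i <;> fin_cases j <;> simp [icoMatA, mul_apply, Fin.sum_univ_two]
    · change !![s, -t; t, s] * _ = _ * !![s, -t; t, s]
      ext i j
      fin_cases i <;> fin_cases j <;> simp [icoMatB, mul_apply, Fin.sum_univ_two]
      · linear_combination e₁
      · linear_combination e₂
      · linear_combination e₂
      · linear_combination -e₁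

theorem IcoTrace.exists_semiconjBy (h2 : (2 : F) ≠ 0) {γ : F} (hγ : γ ^ 2 = γ + 1)
    {A B A' B' : SL(2, F)} (h : IcoTrace γ A B) (h' : IcoTrace γ A' B') :
    ∃ g : GL (Fin 2) F, SemiconjBy g.1 A.1 A'.1 ∧ SemiconjBy g.1 B.1 B'.1 := by
  obtain ⟨P, x, y, hA, hB, hxy⟩ := h.exists_normalForm h2 hγ
  obtain ⟨P', x', y', hA', hB', hxy'⟩ := h'.exists_normalForm h2 hγ
  obtain ⟨g, hg, hg'⟩ := icoMatB_semiconjBy h2 (ne_two_of_sq_eq_add_one hγ) hxy hxy'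
  exact ⟨P' * g * P⁻¹, (hA'.mul_left hg).mul_left hA.units_inv_symm_left,
    (hB'.mul_left hg').mul_left hB.units_inv_symm_left⟩

theorem IcoTrace.eq_scalar_of_commute (h2 : (2 : F) ≠ 0) {γ : F} (hγ : γ ^ 2 = γ + 1)
    {A B : SL(2, F)} (h : IcoTrace γ A B) {W : Matrix (Fin 2) (Fin 2) F}
    (hA : Commute W A.1) (hB : Commute W B.1) : ∃ s : F, W = s • 1 := by
  obtain ⟨P, x, y, hPA, hPB, hxy⟩ := h.exists_normalForm h2 hγ
  set V := (P⁻¹).1 * W * P.1 with hV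
  have hVA : V * icoMatA F = icoMatA F * V := by
    rw [hV, mul_assoc _ P.1, hPA.eq, ← mul_assoc, mul_assoc _ W, hA.eq, ← mul_assoc,
      hPA.units_inv_symm_left.eq]
    simp only [mul_assoc]
  have hVB : V * icoMatB γ x y = icoMatB γ x y * V := by
    rw [hV, mul_assoc _ P.1, hPB.eq, ← mul_assoc, mul_assoc _ W, hB.eq, ← mul_assoc,
      hPB.units_inv_symm_left.eq]
    simp only [mul_assoc]
  have a₁ := congr_fun₂ hVA 0 0
  have a₂ := congr_fun₂ hVA 0 1
  have b₁ := congr_fun₂ hVB 0 0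
  have b₂ := congr_fun₂ hVB 0 1
  simp [icoMatA, mul_apply, Fin.sum_univ_two] at a₁ a₂
  simp [icoMatB, mul_apply, Fin.sum_univ_two] at b₁ b₂
  have h10 : V 1 0 = 0 := by
    refine (mul_eq_zero.mp ?_).resolve_right (ne_two_of_sq_eq_add_one hγ)
    linear_combination -V 1 0 * hxy - (2 * y - γ) * (b₁ - (y - γ) * a₁)
      + (2 * x - 1) * (b₂ - y * a₂ - (1 - 2 * x) * a₁)
  have hVs : V = V 0 0 • 1 := by
    ext i j
    fin_cases i <;> fin_cases j <;> simp [h10]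
    · linear_combination a₁ - h10
    · linear_combination -a₂
  refine ⟨V 0 0, ?_⟩
  have : W = P.1 * V * (P⁻¹).1 := by
    rw [hV]
    simp only [← mul_assoc, Units.mul_inv_cancel_right, Units.mul_inv, one_mul]
  rw [this, hVs]
  simp

end Rigidity

section Classes

open Matrix
open scoped MatrixGroups

variable {F : Type*} [Field F]

/-- Conjugation of an element of `SL(2, F)` by an element of `GL(2, F)`. -/
def glConj (g : GL (Fin 2) F) (X : SL(2, F)) : SL(2, F) :=
  ⟨g.1 * X.1 * (g⁻¹).1, by rw [det_units_conj, X.2]⟩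

theorem semiconjBy_glConj (g : GL (Fin 2) F) (X : SL(2, F)) : SemiconjBy g.1 X.1 (glConj g X).1 := by
  rw [SemiconjBy, glConj, Units.inv_mul_cancel_right]

theorem IcoTrace.glConj {γ : F} {A B : SL(2, F)} (h : IcoTrace γ A B) (g : GL (Fin 2) F) :
    IcoTrace γ (glConj g A) (glConj g B) where
  trace_left := by rw [_root_.glConj, trace_units_conj, h.trace_left]
  trace_right := by rw [_root_.glConj, trace_units_conj, h.trace_right]
  trace_mul := by
    have : (_root_.glConj g A).1 * (_root_.glConj g B).1 = g.1 * (A.1 * B.1) * (g⁻¹).1 := by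
      simp only [_root_.glConj, mul_assoc, Units.inv_mul_cancel_left]
    rw [this, trace_units_conj, h.trace_mul]

theorem exists_eq_smul_of_isSquare_det {g : GL (Fin 2) F} (h : IsSquare g.1.det) :
    ∃ (r : F) (X : SL(2, F)), r ≠ 0 ∧ g.1 = r • X.1 := by
  obtain ⟨r, hr⟩ := h
  have hdet : g.1.det ≠ 0 := ((isUnit_iff_isUnit_det _).mp g.isUnit).ne_zero
  have hr0 : r ≠ 0 := by
    rintro rfl
    simp [hr] at hdet
  refine ⟨r, ⟨r⁻¹ • g.1, ?_⟩, hr0, (smul_inv_smul₀ hr0 _).symm⟩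
  rw [det_smul, hr, Fintype.card_fin]
  field_simp

theorem areConj_range_of_semiconjBy {f f' : alternatingGroup (Fin 5) →* PSL2 F}
    {A B A' B' : SL(2, F)} (hA : f icoA = A) (hB : f icoB = B) (hA' : f' icoA = A')
    (hB' : f' icoB = B') {g : GL (Fin 2) F} (hg : IsSquare g.1.det)
    (hgA : SemiconjBy g.1 A.1 A'.1) (hgB : SemiconjBy g.1 B.1 B'.1) :
    AreConj f.range f'.range := by
  obtain ⟨r, X, hr, hX⟩ := exists_eq_smul_of_isSquare_det hg
  have key : ∀ {C C' : SL(2, F)}, SemiconjBy g.1 C.1 C'.1 → (X * C * X⁻¹ : SL(2, F)) = C' := by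
    intro C C' h
    rw [SemiconjBy, hX, smul_mul_assoc, mul_smul_comm] at h
    rw [mul_inv_eq_iff_eq_mul]
    exact Subtype.ext (smul_right_injective _ hr h)
  refine ⟨X, ?_⟩
  rw [MonoidHom.map_range]
  congr 1
  refine icoHom_ext ?_ ?_
  · rw [hA', ← key hgA, MonoidHom.comp_apply, hA]
    rfl
  · rw [hB', ← key hgB, MonoidHom.comp_apply, hB]
    rfl

theorem exists_icoTrace {p : ℕ} [Fact p.Prime] (h2 : (2 : ZMod p) ≠ 0) {γ : ZMod p}
    (hγ : γ ^ 2 = γ + 1) : ∃ A B : SL(2, ZMod p), IcoTrace γ A B := by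
  obtain ⟨a, b, hab⟩ := ZMod.sq_add_sq p (γ - 2)
  refine ⟨⟨icoMatA _, by simp [icoMatA]⟩, ⟨icoMatB γ ((1 + a) / 2) ((γ + b) / 2), ?_⟩, ?_, ?_, ?_⟩
  · rw [icoMatB, det_fin_two_of]
    field_simp
    linear_combination -hab + hγ
  · simp [icoMatA, trace_fin_two]
  · simp [icoMatB, trace_fin_two]
  · simp [icoMatA, icoMatB, trace_fin_two]

theorem eq_conj_of_conj_eq_conj {G : Type*} [Group G] {a b z s t : G}
    (h : a * s * a⁻¹ = b * (z * t * z⁻¹) * b⁻¹) :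
    ((b * z)⁻¹ * a) * s * ((b * z)⁻¹ * a)⁻¹ = t := by
  have : ((b * z)⁻¹ * a) * s * ((b * z)⁻¹ * a)⁻¹ = (b * z)⁻¹ * (a * s * a⁻¹) * (b * z) := by group
  rw [this, h]
  group

theorem not_areConj_range_of_not_isSquare (h2 : (2 : F) ≠ 0) (h5 : (5 : F) ≠ 0) {γ : F}
    (hγ : γ ^ 2 = γ + 1) {A B : SL(2, F)} (h : IcoTrace γ A B) {D : GL (Fin 2) F}
    (hD : ¬ IsSquare D.1.det) {f f' : alternatingGroup (Fin 5) →* PSL2 F}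
    (hf : Function.Injective f) (hf' : Function.Injective f') (hA : f icoA = A) (hB : f icoB = B)
    (hA' : f' icoA = glConj D A) (hB' : f' icoB = glConj D B) : ¬ AreConj f.range f'.range := by
  rintro ⟨z, hz⟩
  have hmem : ∀ u, ∃ x, f' x = z * f u * z⁻¹ := by
    intro u
    have : z * f u * z⁻¹ ∈ f'.range := by
      rw [← hz]
      exact ⟨f u, ⟨u, rfl⟩, rfl⟩
    exact this
  obtain ⟨x, hx⟩ := hmem icoA
  obtain ⟨y, hy⟩ := hmem icoB
  have hxy : f' (x * y) = z * f (icoA * icoB) * z⁻¹ := by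
    rw [map_mul, hx, hy, map_mul]
    group
  have hne : ∀ {u v}, f' u = z * f v * z⁻¹ → v ≠ 1 → u ≠ 1 := by
    rintro u v huv hv rfl
    rw [map_one, eq_comm, conj_eq_one_iff, map_eq_one_iff f hf] at huv
    exact hv huv
  have hpow : ∀ {u v} {n : ℕ}, f' u = z * f v * z⁻¹ → v ^ n = 1 → u ^ n = 1 := by
    intro u v n huv hv
    apply hf'
    rw [map_pow, huv, conj_pow, ← map_pow, hv]
    simp
  have hrel : IcoRel x y :=
    ⟨hpow hx icoRel_icoB.sq, hpow hy icoRel_icoB.cube, hpow hxy icoRel_icoB.fifth⟩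
  obtain ⟨g, hgx, hgy⟩ := exists_conj_eq_icoA_icoB hrel (hne hx (by decide)) (hne hy (by decide))
    (hne hxy (by decide))
  have h' := h.glConj D
  have hwA : (f' g * z) * A * (f' g * z)⁻¹ = (glConj D A : SL(2, F)) := by
    rw [← hA', ← hgx, map_mul, map_mul, hx, hA, map_inv]
    group
  rcases hgy with hgy | hgy
  · have hwB : (f' g * z) * B * (f' g * z)⁻¹ = (glConj D B : SL(2, F)) := by
      rw [← hB', ← hgy, map_mul, map_mul, hy, hB, map_inv]
      group
    obtain ⟨Z, hZ⟩ := QuotientGroup.mk_surjective (f' g * z)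
    rw [← hZ] at hwA hwB
    have hZB : Z * B * Z⁻¹ = glConj D B := by
      rcases PSL2_mk_eq_mk_iff.mp hwB with e | e
      · exact e
      · have t := trace_conj B Z
        rw [show Z * B * Z⁻¹ = -glConj D B from e] at t
        exfalso
        simp [trace_neg, h.trace_right, h'.trace_right] at t
        exact h2 (by linear_combination -t)
    have hZA : Z * A * Z⁻¹ = glConj D A := by
      rcases PSL2_mk_eq_mk_iff.mp hwA with e | e
      · exact e
      · have e' : Z * (A * B) * Z⁻¹ = -(glConj D A * glConj D B) := by
          rw [← neg_mul, ← show Z * A * Z⁻¹ = -glConj D A from e, ← hZB]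
          group
        have t := trace_conj (A * B) Z
        rw [e'] at t
        exfalso
        simp [trace_neg, h.trace_mul, h'.trace_mul] at t
        have h0 : γ = 0 := by
          refine (mul_eq_zero.mp ?_).resolve_left h2
          linear_combination -t
        simp [h0] at hγ
    have key : ∀ {C : SL(2, F)}, Z * C * Z⁻¹ = glConj D C → Commute ((D⁻¹).1 * Z.1) C.1 := by
      intro C e
      rw [mul_inv_eq_iff_eq_mul] at e
      exact (semiconjBy_glConj D C).units_inv_symm_left.mul_left (congrArg Subtype.val e)
    obtain ⟨s, hs⟩ := h.eq_scalar_of_commute h2 hγ (key hZA) (key hZB)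
    have hZs : Z.1 = s • D.1 := by
      rw [← Units.mul_inv_cancel_left D Z.1, hs, mul_smul_comm, mul_one]
    have hdet := Z.det_coe
    rw [hZs, det_smul, Fintype.card_fin] at hdet
    refine hD ⟨s⁻¹, ?_⟩
    have : s ≠ 0 := by
      rintro rfl
      simp at hdet
    field_simp
    linear_combination hdet
  · obtain ⟨k, hk⟩ := exists_conj_sq_eq
    have hS : ((glConj D A * glConj D B * (glConj D A * glConj D B) : SL(2, F)) : PSL2 F) =
        f' (icoA * icoB * (icoA * icoB)) := by
      simp only [QuotientGroup.mk_mul, map_mul, hA', hB']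
    have hT : ((A * B : SL(2, F)) : PSL2 F) = f (icoA * icoB) := by
      rw [QuotientGroup.mk_mul, map_mul, hA, hB]
    have e₁ : f' k * f' (icoA * icoB * (icoA * icoB)) * (f' k)⁻¹ =
        f' g * (z * f (icoA * icoB) * z⁻¹) * (f' g)⁻¹ := by
      rw [← hxy, ← map_mul, ← map_inv, ← map_mul, hk, ← map_mul, ← map_inv, ← map_mul, ← conj_mul,
        hgx, hgy]
    have e := eq_conj_of_conj_eq_conj e₁
    rw [← hS, ← hT] at e
    have t := trace_eq_of_mk_conj e
    have t₁ : (A * B).1.trace = γ := h.trace_mul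
    have t₂ : (glConj D A * glConj D B).1.trace = γ := h'.trace_mul
    rw [trace_sq, t₁, t₂] at t
    rcases t with t | t
    · exact one_ne_zero (α := F) (by linear_combination t + hγ)
    · have h3 : 2 * γ = 1 := by linear_combination t - hγ
      exact h5 (by linear_combination (2 * γ - 1) * h3 - 4 * hγ)

theorem exists_two_classes {p : ℕ} [Fact p.Prime] (h2 : (2 : ZMod p) ≠ 0) (h5 : (5 : ZMod p) ≠ 0)
    {γ : ZMod p} (hγ : γ ^ 2 = γ + 1) :
    ∃ f₁ f₂ : alternatingGroup (Fin 5) →* PSL2 (ZMod p), Function.Injective f₁ ∧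
      Function.Injective f₂ ∧ ¬ AreConj f₁.range f₂.range ∧
      ∀ f : alternatingGroup (Fin 5) →* PSL2 (ZMod p), Function.Injective f →
        AreConj f.range f₁.range ∨ AreConj f.range f₂.range := by
  have hchar : ringChar (ZMod p) ≠ 2 := by
    intro h
    have := ringChar.Nat.cast_ringChar (R := ZMod p)
    rw [h] at this
    exact h2 (mod_cast this)
  obtain ⟨n, hn⟩ := FiniteField.exists_nonsquare hchar
  have hn0 : n ≠ 0 := by
    rintro rfl
    exact hn (IsSquare.zero)
  obtain ⟨A, B, h⟩ := exists_icoTrace h2 hγ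
  set D : GL (Fin 2) (ZMod p) := GeneralLinearGroup.mkOfDetNeZero !![n, 0; 0, 1] (by simpa) with hD
  have hdet : D.1.det = n := by
    change det !![n, 0; 0, 1] = n
    simp
  obtain ⟨f₁, hf₁, hA, hB⟩ := h.exists_hom h2 hγ
  obtain ⟨f₂, hf₂, hA', hB'⟩ := (h.glConj D).exists_hom h2 hγ
  refine ⟨f₁, f₂, hf₁, hf₂, not_areConj_range_of_not_isSquare h2 h5 hγ h (hdet ▸ hn) hf₁ hf₂ hA hB
    hA' hB', fun f hf => ?_⟩
  obtain ⟨f', hf', hr, X, Y, hXY, hX, hY⟩ := exists_normalized_lift h2 hγ hf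
  rw [← hr]
  obtain ⟨g, hgA, hgB⟩ := hXY.exists_semiconjBy h2 hγ h
  by_cases hg : IsSquare g.1.det
  · exact Or.inl (areConj_range_of_semiconjBy hX hY hA hB hg hgA hgB)
  · refine Or.inr (areConj_range_of_semiconjBy hX hY hA' hB' (g := D * g) ?_
      ((semiconjBy_glConj D A).mul_left hgA) ((semiconjBy_glConj D B).mul_left hgB))
    rw [Units.val_mul, det_mul, hdet]
    have hg0 : g.1.det ≠ 0 := ((isUnit_iff_isUnit_det _).mp g.isUnit).ne_zero
    rw [← quadraticChar_neg_one_iff_not_isSquare] at hg hn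
    rw [← quadraticChar_one_iff_isSquare (mul_ne_zero hn0 hg0), map_mul, hg, hn]
    rfl

end Classes

section CommonEigenvector

open Matrix
open scoped MatrixGroups

variable {F : Type*} [Field F]

theorem IcoTrace.not_common_eigenvector {γ : F} (hγ : γ ^ 2 = γ + 1) {A B : SL(2, F)}
    (h : IcoTrace γ A B) {v : Fin 2 → F} (hv : v ≠ 0) {l m : F} (hA : A.1 *ᵥ v = l • v)
    (hB : B.1 *ᵥ v = m • v) : False := by
  have key : ∀ {X : SL(2, F)} {k : F}, X.1 *ᵥ v = k • v → k ^ 2 = X.1.trace * k - 1 := by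
    intro X k hX
    have h₁ : (X.1 * X.1) *ᵥ v = k ^ 2 • v := by
      rw [← mulVec_mulVec, hX, mulVec_smul, hX, smul_smul, pow_two]
    rw [SL_two_mul_self_eq, sub_mulVec, smul_mulVec, hX, one_mulVec, smul_smul] at h₁
    refine smul_left_injective F hv ?_
    simp only [sub_smul, one_smul]
    exact h₁.symm
  have hAB : (A * B).1 *ᵥ v = (l * m) • v := by
    rw [Matrix.SpecialLinearGroup.coe_mul, ← mulVec_mulVec, hB, mulVec_smul, hA, smul_smul, mul_comm]
  have a := key hA
  have b := key hB
  have c := key hAB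
  rw [show (A * B).1.trace = γ from h.trace_mul] at c
  rw [h.trace_left] at a
  rw [h.trace_right] at b
  have hm : (γ - 2) * (1 - m) = 0 := by
    have e : γ * (l * m) = 2 - m := by linear_combination m ^ 2 * a - b - c
    linear_combination (γ * (l * m) + 2 - m) * e - γ ^ 2 * (m ^ 2 * a - b) - (1 - m) * hγ + b
  have := (mul_eq_zero.mp hm).resolve_left (ne_two_of_sq_eq_add_one hγ)
  exact one_ne_zero (α := F) (by linear_combination b + m * this)

theorem IcoTrace.map {γ : F} {A B : SL(2, F)} (h : IcoTrace γ A B) {K : Type*} [Field K]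
    (φ : F →+* K) :
    IcoTrace (φ γ) (SpecialLinearGroup.map φ A) (SpecialLinearGroup.map φ B) := by
  obtain ⟨h₁, h₂, h₃⟩ := h
  rw [trace_fin_two] at *
  refine ⟨?_, ?_, ?_⟩ <;> rw [trace_fin_two]
  · simpa using congrArg φ h₁
  · simpa using congrArg φ h₂
  · simpa [mul_apply, Fin.sum_univ_two] using congrArg φ h₃

theorem eq_top_of_transvection_mem {K : Subgroup SL(2, F)}
    (hK : ∀ c, SpecialLinearGroup.transvection (zero_ne_one (α := Fin 2)) c ∈ K) {m : SL(2, F)}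
    (hm : m ∈ K) (hc : m.1 1 0 ≠ 0) : K = ⊤ := by
  set U : F → SL(2, F) := fun c => SpecialLinearGroup.transvection (zero_ne_one (α := Fin 2)) c
    with hU
  have hdet := m.det_coe
  rw [det_fin_two] at hdet
  set w : SL(2, F) := U (-m.1 0 0 / m.1 1 0) * m * U (-m.1 1 1 / m.1 1 0) with hw
  have hwK : w ∈ K := mul_mem (mul_mem (hK _) hm) (hK _)
  have hwe : w.1 = !![0, -(m.1 1 0)⁻¹; m.1 1 0, 0] := by
    ext i j
    fin_cases i <;> fin_cases j <;>
      simp [hw, hU, SpecialLinearGroup.transvection_coe, mul_apply, Fin.sum_univ_two] <;>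
      field_simp <;> first | linear_combination hdet | linear_combination -hdet | ring
  clear_value w
  have hL : ∀ y, SpecialLinearGroup.transvection (one_ne_zero (α := Fin 2)) y ∈ K := by
    intro y
    have : SpecialLinearGroup.transvection (one_ne_zero (α := Fin 2)) y =
        w * U (-y / m.1 1 0 ^ 2) * w⁻¹ := by
      rw [eq_mul_inv_iff_mul_eq]
      ext i j
      rw [Matrix.SpecialLinearGroup.coe_mul, Matrix.SpecialLinearGroup.coe_mul, hwe]
      fin_cases i <;> fin_cases j <;>
        simp [hU, SpecialLinearGroup.transvection_coe, mul_apply, Fin.sum_univ_two]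
      field_simp
    rw [this]
    exact mul_mem (mul_mem hwK (hK _)) (inv_mem hwK)
  refine (Subgroup.eq_top_iff' K).mpr fun X => ?_
  refine SL2.transvection_induction (fun Y => Y ∈ K) ?_ (fun _ _ => mul_mem) X
  intro i j hij c
  fin_cases i <;> fin_cases j
  · exact absurd rfl hij
  · exact hK c
  · exact hL c
  · exact absurd rfl hij

end CommonEigenvector

section Unipotent

open Matrix
open scoped MatrixGroups

variable {F : Type*} [Field F]

theorem coe_glConj (g : GL (Fin 2) F) (X : SL(2, F)) : (glConj g X).1 = g.1 * X.1 * (g⁻¹).1 :=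
  rfl

theorem glConj_mul (g : GL (Fin 2) F) (X Y : SL(2, F)) :
    glConj g (X * Y) = glConj g X * glConj g Y := by
  refine Subtype.ext ?_
  rw [Matrix.SpecialLinearGroup.coe_mul, coe_glConj, coe_glConj, coe_glConj,
    Matrix.SpecialLinearGroup.coe_mul]
  simp only [mul_assoc, Units.inv_mul_cancel_left]

theorem glConj_glConj_inv (g : GL (Fin 2) F) (X : SL(2, F)) : glConj g (glConj g⁻¹ X) = X := by
  refine Subtype.ext ?_
  rw [coe_glConj, coe_glConj]
  simp only [mul_assoc, inv_inv, Units.mul_inv_cancel_left, Units.mul_inv, mul_one]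

theorem pow_char_eq_one_iff_trace_eq_two {p : ℕ} [Fact p.Prime] [CharP F p] {V : SL(2, F)} :
    V.1 ^ p = 1 ↔ V.1.trace = 2 := by
  have h : (V.1 - 1) ^ p = V.1 ^ p - 1 := by
    rw [sub_pow_char_of_commute _ (Commute.one_right V.1), one_pow]
  have hdet : (V.1 - 1).det = 2 - V.1.trace := by
    have := V.det_coe
    rw [det_fin_two] at this
    rw [det_fin_two, trace_fin_two]
    simp only [Matrix.sub_apply, one_apply_eq, ne_eq, zero_ne_one, one_ne_zero, not_false_eq_true,
      one_apply_ne]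
    linear_combination this
  constructor
  · intro hV
    rw [hV, sub_self] at h
    have := congrArg det h
    rw [det_pow, det_zero] at this
    rw [hdet] at this
    exact (sub_eq_zero.mp (eq_zero_of_pow_eq_zero this)).symm
  · intro hV
    have hsq : (V.1 - 1) ^ 2 = 0 := by
      rw [pow_two, sub_mul, mul_sub, SL_two_mul_self_eq, hV, two_smul, mul_one, one_mul]
      abel
    rw [pow_eq_zero_of_le (Fact.out : p.Prime).two_le hsq] at h
    exact (sub_eq_zero.mp h.symm)

theorem exists_glConj_transvection_eq {V : SL(2, F)} (hV : V.1.trace = 2) (h1 : V ≠ 1) :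
    ∃ P : GL (Fin 2) F,
      glConj P (SpecialLinearGroup.transvection (zero_ne_one (α := Fin 2)) 1) = V := by
  have key : ∀ P : GL (Fin 2) F, P.1 * !![1, 1; 0, 1] = V.1 * P.1 →
      glConj P (SpecialLinearGroup.transvection (zero_ne_one (α := Fin 2)) 1) = V := by
    intro P hP
    have : (SpecialLinearGroup.transvection (zero_ne_one (α := Fin 2)) (1 : F)).1 =
        !![1, 1; 0, 1] := by
      ext i j
      fin_cases i <;> fin_cases j <;> simp [SpecialLinearGroup.transvection_coe]
    refine Subtype.ext ?_
    rw [coe_glConj, this, hP, Units.mul_inv_cancel_right]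
  have hdet := V.det_coe
  rw [det_fin_two] at hdet
  rw [trace_fin_two] at hV
  by_cases hc : V.1 1 0 = 0
  · have h11 : V.1 1 1 = 1 := by
      rw [hc] at hdet
      have : (V.1 1 1 - 1) ^ 2 = 0 := by linear_combination V.1 1 1 * hV - hdet
      linear_combination pow_eq_zero_iff two_ne_zero |>.mp this
    have h00 : V.1 0 0 = 1 := by linear_combination hV - h11
    have hb : V.1 0 1 ≠ 0 := by
      intro hb
      apply h1
      ext i j
      fin_cases i <;> fin_cases j <;> simp [*]
    refine ⟨GeneralLinearGroup.mkOfDetNeZero !![V.1 0 1, 0; 0, 1] (by simpa), key _ ?_⟩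
    ext i j
    fin_cases i <;> fin_cases j <;>
      simp [GeneralLinearGroup.mkOfDetNeZero, mul_apply, Fin.sum_univ_two, *]
  · refine ⟨GeneralLinearGroup.mkOfDetNeZero !![V.1 0 0 - 1, 1; V.1 1 0, 0] (by simpa), key _ ?_⟩
    ext i j
    fin_cases i <;> fin_cases j <;>
      simp [GeneralLinearGroup.mkOfDetNeZero, mul_apply, Fin.sum_univ_two]
    · linear_combination hdet - V.1 0 0 * hV
    · linear_combination -V.1 1 0 * hV

theorem transvection_natCast {i j : Fin 2} (hij : i ≠ j) (n : ℕ) :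
    SpecialLinearGroup.transvection hij (n : F) = SpecialLinearGroup.transvection hij 1 ^ n := by
  induction n with
  | zero => simp [SpecialLinearGroup.transvection_coeff_zero]
  | succ n ih => rw [Nat.cast_succ, SpecialLinearGroup.transvection_add, ih, pow_succ]

theorem exists_lift_unipotent {p : ℕ} [Fact p.Prime] [CharP F p] (h2 : (2 : F) ≠ 0)
    {u : PSL2 F} (hu : orderOf u = p) :
    ∃ V : SL(2, F), V ≠ 1 ∧ V.1.trace = 2 ∧ (V : PSL2 F) ∈ Subgroup.zpowers u := by
  obtain ⟨U, rfl⟩ := QuotientGroup.mk_surjective u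
  have hp : p.Prime := Fact.out
  have hU := PSL2_mk_pow_eq_one_iff.mp (hu ▸ pow_orderOf_eq_one (U : PSL2 F))
  refine ⟨U ^ 2, ?_, ?_, ?_⟩
  · intro h
    have h' : (U : PSL2 F) ^ 2 = 1 := by rw [← QuotientGroup.mk_pow, h, QuotientGroup.mk_one]
    have := (Nat.prime_dvd_prime_iff_eq hp Nat.prime_two).mp (hu ▸ orderOf_dvd_of_pow_eq_one h')
    subst this
    exact h2 (CharP.cast_eq_zero F 2)
  · rw [← pow_char_eq_one_iff_trace_eq_two (p := p), Matrix.SpecialLinearGroup.coe_pow, ← pow_mul,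
      mul_comm, pow_mul]
    rcases hU with h | h <;> simp [h]
  · rw [QuotientGroup.mk_pow]
    exact pow_mem (Subgroup.mem_zpowers _) _

theorem eq_top_of_prime_dvd_card {p : ℕ} [Fact p.Prime] (h2 : (2 : ZMod p) ≠ 0) {γ : ZMod p}
    (hγ : γ ^ 2 = γ + 1) {A B : SL(2, ZMod p)} (h : IcoTrace γ A B)
    {H : Subgroup (PSL2 (ZMod p))} (hA : (A : PSL2 (ZMod p)) ∈ H) (hB : (B : PSL2 (ZMod p)) ∈ H)
    (hp : p ∣ Nat.card H) : H = ⊤ := by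
  obtain ⟨⟨u, huH⟩, hu⟩ := exists_prime_orderOf_dvd_card' p hp
  rw [Subgroup.orderOf_mk] at hu
  obtain ⟨V, hV1, hV, hVu⟩ := exists_lift_unipotent h2 hu
  obtain ⟨P, rfl⟩ := exists_glConj_transvection_eq hV hV1
  set K : Subgroup SL(2, ZMod p) :=
    H.comap ((QuotientGroup.mk' _).comp (MonoidHom.mk' (glConj P) (glConj_mul P))) with hKdef
  have hK : ∀ {X : SL(2, ZMod p)}, X ∈ K ↔ (glConj P X : PSL2 (ZMod p)) ∈ H := Iff.rfl
  have hmem : ∀ {X : SL(2, ZMod p)}, (X : PSL2 (ZMod p)) ∈ H → glConj P⁻¹ X ∈ K := by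
    intro X hX
    rwa [hK, glConj_glConj_inv]
  have htr : ∀ c, SpecialLinearGroup.transvection (zero_ne_one (α := Fin 2)) c ∈ K := by
    intro c
    rw [← ZMod.natCast_zmod_val c, transvection_natCast]
    exact pow_mem (hK.mpr (Subgroup.zpowers_le.mpr huH hVu)) _
  have hKtop : K = ⊤ := by
    by_contra hne
    have e : ∀ {X : SL(2, ZMod p)}, X ∈ K → X.1 *ᵥ ![1, 0] = X.1 0 0 • ![1, 0] := by
      intro X hX
      have : X.1 1 0 = 0 := by
        by_contra hc
        exact hne (eq_top_of_transvection_mem htr hX hc)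
      ext i
      fin_cases i <;> simp [mulVec, dotProduct, Fin.sum_univ_two, this]
    exact (h.glConj P⁻¹).not_common_eigenvector hγ (by simp) (e (hmem hA)) (e (hmem hB))
  refine (Subgroup.eq_top_iff' H).mpr fun x => ?_
  obtain ⟨X, rfl⟩ := QuotientGroup.mk_surjective x
  have : glConj P⁻¹ X ∈ K := hKtop ▸ Subgroup.mem_top _
  rwa [hK, glConj_glConj_inv] at this

end Unipotent

section ProjectiveLine

open Matrix
open scoped MatrixGroups

variable {F K : Type*} [Field F] [Field K] [DecidableEq K]

theorem smul_coe_eq_self_iff {g : GL (Fin 2) K} {z : K} : g • (z : OnePoint K) = z ↔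
    g.1 1 0 * z ^ 2 + (g.1 1 1 - g.1 0 0) * z - g.1 0 1 = 0 := by
  rw [← GeneralLinearGroup.fixpointPolynomial_aeval_eq_zero_iff]
  simp [GeneralLinearGroup.fixpointPolynomial]

theorem exists_mulVec_eq_smul_of_fixed (x : OnePoint K) : ∃ v : Fin 2 → K, v ≠ 0 ∧
    ∀ g : GL (Fin 2) K, g • x = x → ∃ l : K, g.1 *ᵥ v = l • v := by
  cases x with
  | infty =>
    refine ⟨![1, 0], by simp, fun g hg => ⟨g.1 0 0, ?_⟩⟩
    have := OnePoint.smul_infty_eq_self_iff.mp hg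
    ext i
    fin_cases i <;> simp [mulVec, dotProduct, Fin.sum_univ_two, this]
  | coe z =>
    refine ⟨![z, 1], by simp, fun g hg => ⟨g.1 1 0 * z + g.1 1 1, ?_⟩⟩
    have := smul_coe_eq_self_iff.mp hg
    ext i
    fin_cases i <;> simp [mulVec, dotProduct, Fin.sum_univ_two]
    linear_combination -this

theorem card_fixedBy_onePoint (h2 : (2 : K) ≠ 0) {g : GL (Fin 2) K} {s : K} (hs : s ≠ 0)
    (h : g.1.trace ^ 2 - 4 * g.1.det = s ^ 2) :
    Nat.card (MulAction.fixedBy (OnePoint K) g) = 2 := by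
  rw [trace_fin_two, det_fin_two] at h
  rw [Nat.card_coe_set_eq, Set.ncard_eq_two]
  by_cases hc : g.1 1 0 = 0
  · have hd : g.1 1 1 - g.1 0 0 ≠ 0 := by
      intro hd
      exact hs (eq_zero_of_pow_eq_zero (n := 2) (by
        rw [← h]; linear_combination (g.1 1 1 - g.1 0 0) * hd + 4 * g.1 0 1 * hc))
    refine ⟨OnePoint.infty, (g.1 0 1 / (g.1 1 1 - g.1 0 0) : K), OnePoint.infty_ne_coe _, ?_⟩
    ext x
    rw [MulAction.mem_fixedBy]
    cases x with
    | infty => simpa [OnePoint.smul_infty_eq_self_iff] using hc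
    | coe z =>
      rw [smul_coe_eq_self_iff, hc]
      simp only [Set.mem_insert_iff, OnePoint.coe_ne_infty, Set.mem_singleton_iff,
        OnePoint.coe_eq_coe, false_or, eq_div_iff hd]
      constructor <;> intro e <;> linear_combination e
  · have hc2 : 2 * g.1 1 0 ≠ 0 := mul_ne_zero h2 hc
    refine ⟨((g.1 0 0 - g.1 1 1 + s) / (2 * g.1 1 0) : K),
      ((g.1 0 0 - g.1 1 1 - s) / (2 * g.1 1 0) : K), ?_, ?_⟩
    · rw [Ne, OnePoint.coe_eq_coe, div_left_inj' hc2]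
      intro e
      exact mul_ne_zero h2 hs (by linear_combination e)
    · ext x
      rw [MulAction.mem_fixedBy]
      cases x with
      | infty => simpa [OnePoint.smul_infty_eq_self_iff] using hc
      | coe z =>
        rw [smul_coe_eq_self_iff]
        simp only [Set.mem_insert_iff, Set.mem_singleton_iff, OnePoint.coe_eq_coe,
          eq_div_iff hc2]
        have e : (z * (2 * g.1 1 0) - (g.1 0 0 - g.1 1 1 + s)) *
            (z * (2 * g.1 1 0) - (g.1 0 0 - g.1 1 1 - s)) = (2 * (2 * g.1 1 0)) *
            (g.1 1 0 * z ^ 2 + (g.1 1 1 - g.1 0 0) * z - g.1 0 1) := by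
          linear_combination h
        rw [← sub_eq_zero (a := z * (2 * g.1 1 0)), ← sub_eq_zero (a := z * (2 * g.1 1 0)),
          ← mul_eq_zero, e, mul_eq_zero, or_iff_right (mul_ne_zero h2 hc2)]

/-- The action of `PSL(2, F)` by Möbius transformations on the projective line over an extension
field of `F`. -/
noncomputable def moebiusHom (φ : F →+* K) : PSL2 F →* Equiv.Perm (OnePoint K) :=
  QuotientGroup.lift _ ((MulAction.toPermHom (GL (Fin 2) K) (OnePoint K)).comp
    (SpecialLinearGroup.toGL.comp (SpecialLinearGroup.map φ))) fun X hX => by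
      ext x
      rcases mem_center_SL_two_iff.mp hX with rfl | rfl
      · rw [map_one]
      · change SpecialLinearGroup.toGL (SpecialLinearGroup.map φ (-1 : SL(2, F))) • x = x
        cases x with
        | infty =>
          rw [OnePoint.smul_infty_eq_self_iff]
          simp
        | coe z =>
          rw [smul_coe_eq_self_iff]
          simp

theorem card_fixedBy_moebiusHom (h2 : (2 : K) ≠ 0) (φ : F →+* K) (hφ : ∀ x, IsSquare (φ x))
    {X : SL(2, F)} (h1 : X.1.trace ≠ 2) (h1' : X.1.trace ≠ -2) :
    Nat.card {x | moebiusHom φ X x = x} = 2 := by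
  obtain ⟨s, hs⟩ := hφ (X.1.trace ^ 2 - 4)
  have hX : X.1.trace ^ 2 - 4 ≠ 0 := by
    rw [show X.1.trace ^ 2 - 4 = (X.1.trace - 2) * (X.1.trace - -2) by ring]
    exact mul_ne_zero (sub_ne_zero.mpr h1) (sub_ne_zero.mpr h1')
  refine card_fixedBy_onePoint h2 (g := SpecialLinearGroup.toGL (SpecialLinearGroup.map φ X))
    (s := s) ?_ ?_
  · rintro rfl
    exact hX ((map_eq_zero φ).mp (by rw [hs, mul_zero]))
  · change (SpecialLinearGroup.map φ X).1.trace ^ 2 - 4 * (SpecialLinearGroup.map φ X).1.det = s ^ 2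
    rw [(SpecialLinearGroup.map φ X).det_coe, pow_two s, ← hs, trace_fin_two, trace_fin_two]
    simpa using (map_ofNat φ 4).symm

theorem IcoTrace.not_fixed {γ : F} (hγ : γ ^ 2 = γ + 1) {A B : SL(2, F)} (h : IcoTrace γ A B)
    (φ : F →+* K) {x : OnePoint K} (hA : moebiusHom φ A x = x) : moebiusHom φ B x ≠ x := by
  intro hB
  obtain ⟨v, hv, key⟩ := exists_mulVec_eq_smul_of_fixed x
  obtain ⟨l, hl⟩ := key _ hA
  obtain ⟨m, hm⟩ := key _ hB
  exact (h.map φ).not_common_eigenvector (by rw [← map_pow, hγ, map_add, map_one]) hv hl hm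

end ProjectiveLine

section Maximal

open Matrix
open scoped MatrixGroups

theorem isSquare_algebraMap_galoisField {p : ℕ} [Fact p.Prime] (hp : p ≠ 2) (x : ZMod p) :
    IsSquare (algebraMap (ZMod p) (GaloisField p 2) x) := by
  rcases eq_or_ne x 0 with rfl | hx
  · simp
  have := Fintype.ofFinite (GaloisField p 2)
  rw [FiniteField.isSquare_iff (by rwa [ringChar.eq _ p]) (by simpa), ← Nat.card_eq_fintype_card,
    GaloisField.card p 2 two_ne_zero, ← map_pow]
  obtain ⟨k, hk⟩ := (Fact.out : p.Prime).odd_of_ne_two hp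
  have : p ^ 2 / 2 = (p - 1) * (k + 1) := by
    rw [hk]
    refine Nat.div_eq_of_lt_le ?_ ?_ <;> rw [Nat.add_sub_cancel] <;> nlinarith
  rw [this, pow_mul, ZMod.pow_card_sub_one_eq_one hx, one_pow, map_one]

theorem prime_dvd_card_of_trace_eq {p : ℕ} [Fact p.Prime] {X : SL(2, ZMod p)}
    {H : Subgroup (PSL2 (ZMod p))} (hX : (X : PSL2 (ZMod p)) ∈ H) (h1 : (X : PSL2 (ZMod p)) ≠ 1)
    (ht : X.1.trace = 2 ∨ X.1.trace = -2) : p ∣ Nat.card H := by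
  have hp : (X : PSL2 (ZMod p)) ^ p = 1 := by
    rcases ht with ht | ht
    · exact PSL2_mk_pow_eq_one_iff.mpr (Or.inl (pow_char_eq_one_iff_trace_eq_two.mpr ht))
    · rw [← PSL2_mk_neg]
      refine PSL2_mk_pow_eq_one_iff.mpr (Or.inl (pow_char_eq_one_iff_trace_eq_two.mpr ?_))
      rw [Matrix.SpecialLinearGroup.coe_neg, trace_neg, ht, neg_neg]
  have := orderOf_dvd_natCard (⟨_, hX⟩ : H)
  rwa [Subgroup.orderOf_mk, orderOf_eq_prime hp h1] at this

theorem card_le_sixty_of_not_dvd {p : ℕ} [Fact p.Prime] (hp2 : p ≠ 2) {γ : ZMod p}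
    (hγ : γ ^ 2 = γ + 1) {A B : SL(2, ZMod p)} (h : IcoTrace γ A B)
    {H : Subgroup (PSL2 (ZMod p))} (hA : (A : PSL2 (ZMod p)) ∈ H) (hB : (B : PSL2 (ZMod p)) ∈ H)
    (hp : ¬ p ∣ Nat.card H) : Nat.card H ≤ 60 := by
  classical
  by_contra! hH
  set φ := algebraMap (ZMod p) (GaloisField p 2)
  let _ : MulAction H (OnePoint (GaloisField p 2)) :=
    MulAction.compHom _ ((moebiusHom φ).comp H.subtype)
  have : Finite (OnePoint (GaloisField p 2)) :=
    inferInstanceAs (Finite (Option (GaloisField p 2)))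
  have h2 : (2 : GaloisField p 2) ≠ 0 := Ring.two_ne_zero (by rwa [ringChar.eq _ p])
  obtain ⟨x, hx⟩ := exists_index_stabilizer_le_two (G := H) (X := OnePoint (GaloisField p 2)) (by
    rintro ⟨g, hg⟩ hg1
    obtain ⟨X, rfl⟩ := QuotientGroup.mk_surjective g
    have hX : (X : PSL2 (ZMod p)) ≠ 1 := fun e => hg1 (Subtype.ext e)
    exact card_fixedBy_moebiusHom h2 φ (isSquare_algebraMap_galoisField hp2)
      (fun e => hp (prime_dvd_card_of_trace_eq hg hX (Or.inl e)))
      (fun e => hp (prime_dvd_card_of_trace_eq hg hX (Or.inr e)))) hH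
  set S := MulAction.stabilizer H x
  have hsq : ∀ y : H, y ^ 2 ∈ S := by
    intro y
    have h0 : S.index ≠ 0 := Subgroup.index_ne_zero_of_finite
    obtain h1 | h1 : S.index = 1 ∨ S.index = 2 := by omega
    · rw [Subgroup.index_eq_one.mp h1]
      exact Subgroup.mem_top _
    · exact Subgroup.sq_mem_of_index_two h1 y
  have hrel := h.icoRel hγ
  set a : H := ⟨A, hA⟩
  set b : H := ⟨B, hB⟩
  have hbS : b ∈ S := by
    have e : b ^ 3 = 1 := Subtype.ext hrel.cube
    have : b = (b ^ 2) ^ 2 := by rw [← pow_mul, pow_succ, e, one_mul]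
    rw [this]
    exact hsq _
  have haS : a ∈ S := by
    have e : (a * b) ^ 5 = 1 := Subtype.ext hrel.fifth
    have : a * b = ((a * b) ^ 3) ^ 2 := by rw [← pow_mul, pow_succ, e, one_mul]
    exact (mul_mem_cancel_right hbS).mp (this ▸ hsq _)
  exact h.not_fixed hγ φ haS hbS

theorem natCard_range_of_injective {G : Type*} [Group G] {f : alternatingGroup (Fin 5) →* G}
    (hf : Function.Injective f) : Nat.card f.range = 60 := by
  rw [← Nat.card_congr (f.ofInjective hf).toEquiv, nat_card_alternatingGroup,
    Nat.card_eq_fintype_card, Fintype.card_fin]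
  rfl

theorem isCoatom_range {p : ℕ} [Fact p.Prime] (hp : ¬ p ∣ 60) {γ : ZMod p} (hγ : γ ^ 2 = γ + 1)
    {f : alternatingGroup (Fin 5) →* PSL2 (ZMod p)} (hf : Function.Injective f) :
    IsCoatom f.range := by
  have hp2 : p ≠ 2 := by
    rintro rfl
    exact hp (by decide)
  have h2 : (2 : ZMod p) ≠ 0 := Ring.two_ne_zero (by rwa [ZMod.ringChar_zmod_n])
  have hcard := natCard_range_of_injective hf
  refine ⟨fun htop => ?_, fun H hH => ?_⟩
  · set V : SL(2, ZMod p) := SpecialLinearGroup.transvection (zero_ne_one (α := Fin 2)) 1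
    refine hp (hcard ▸ prime_dvd_card_of_trace_eq (X := V) (htop ▸ Subgroup.mem_top _) ?_ (Or.inl ?_))
    · rw [Ne, QuotientGroup.eq_one_iff, SpecialLinearGroup.transvection_mem_center_iff]
      exact one_ne_zero
    · simp [V, SpecialLinearGroup.transvection_coe]
  · obtain ⟨f', hf', hr, A, B, h, hA, hB⟩ := exists_normalized_lift h2 hγ hf
    have hAH : (A : PSL2 (ZMod p)) ∈ H := hH.le (hr ▸ ⟨_, hA⟩)
    have hBH : (B : PSL2 (ZMod p)) ∈ H := hH.le (hr ▸ ⟨_, hB⟩)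
    by_cases hpH : p ∣ Nat.card H
    · exact eq_top_of_prime_dvd_card h2 hγ h hAH hBH hpH
    · have := card_le_sixty_of_not_dvd hp2 hγ h hAH hBH hpH
      exact absurd (Subgroup.eq_of_le_of_card_ge hH.le (by rwa [hcard])) hH.ne

theorem exists_injective_range_eq {G : Type*} [Group G] {M : Subgroup G}
    (e : Nonempty (M ≃* alternatingGroup (Fin 5))) :
    ∃ f : alternatingGroup (Fin 5) →* G, Function.Injective f ∧ f.range = M := by
  obtain ⟨e⟩ := e
  refine ⟨M.subtype.comp e.symm.toMonoidHom, M.subtype_injective.comp e.symm.injective, ?_⟩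
  rw [MonoidHom.range_comp, MonoidHom.range_eq_top.mpr e.symm.surjective, ← MonoidHom.range_eq_map,
    Subgroup.range_subtype]

theorem isMaxAlt5_range {p : ℕ} [Fact p.Prime] (hp : ¬ p ∣ 60) {γ : ZMod p} (hγ : γ ^ 2 = γ + 1)
    {f : alternatingGroup (Fin 5) →* PSL2 (ZMod p)} (hf : Function.Injective f) :
    IsMaxAlt5 p f.range :=
  ⟨isCoatom_range hp hγ hf, ⟨(f.ofInjective hf).symm⟩⟩

theorem isSquare_five_iff {p : ℕ} [Fact p.Prime] (hodd : Odd p) (h5 : p ≠ 5) :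
    IsSquare (5 : ZMod p) ↔ p % 10 = 1 ∨ p % 10 = 9 := by
  have hsq : ∀ r : ℕ, r < 5 → r ≠ 0 → (IsSquare (r : ZMod 5) ↔ r = 1 ∨ r = 4) := by decide
  have : Fact (Nat.Prime 5) := ⟨Nat.prime_five⟩
  have hp2 : p ≠ 2 := by
    rintro rfl
    exact absurd hodd (by decide)
  have h := ZMod.exists_sq_eq_prime_iff_of_mod_four_eq_one (p := 5) (q := p) rfl hp2
  rw [Nat.cast_ofNat] at h
  rw [← h, ← ZMod.natCast_mod p 5]
  have hp5 : p % 5 ≠ 0 := fun e =>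
    h5 ((Nat.prime_dvd_prime_iff_eq Nat.prime_five Fact.out).mp (Nat.dvd_of_mod_eq_zero e)).symm
  rw [hsq _ (Nat.mod_lt _ (by norm_num)) hp5]
  have := Nat.odd_iff.mp hodd
  omega

theorem exists_sq_eq_add_one {F : Type*} [Field F] (h2 : (2 : F) ≠ 0) (h5 : IsSquare (5 : F)) :
    ∃ γ : F, γ ^ 2 = γ + 1 := by
  obtain ⟨s, hs⟩ := h5
  refine ⟨(1 + s) / 2, ?_⟩
  field_simp
  linear_combination -hs

end Maximal

theorem stmt_10 (p : ℕ) [Fact p.Prime] (hodd : Odd p) :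
    ((∃ M : Subgroup (PSL2 (ZMod p)), IsMaxAlt5 p M) ↔ (p % 10 = 1 ∨ p % 10 = 9)) ∧
    ((p % 10 = 1 ∨ p % 10 = 9) →
      ∃ M₁ M₂ : Subgroup (PSL2 (ZMod p)), IsMaxAlt5 p M₁ ∧ IsMaxAlt5 p M₂ ∧
        ¬ AreConj M₁ M₂ ∧
        ∀ M : Subgroup (PSL2 (ZMod p)), IsMaxAlt5 p M → AreConj M M₁ ∨ AreConj M M₂) := by
  have hp : p.Prime := Fact.out
  have hp2 : p ≠ 2 := by
    rintro rfl
    exact absurd hodd (by decide)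
  have h2 : (2 : ZMod p) ≠ 0 := Ring.two_ne_zero (by rwa [ZMod.ringChar_zmod_n])
  have main : (p % 10 = 1 ∨ p % 10 = 9) →
      ∃ M₁ M₂ : Subgroup (PSL2 (ZMod p)), IsMaxAlt5 p M₁ ∧ IsMaxAlt5 p M₂ ∧
        ¬ AreConj M₁ M₂ ∧
        ∀ M : Subgroup (PSL2 (ZMod p)), IsMaxAlt5 p M → AreConj M M₁ ∨ AreConj M M₂ := by
    intro hmod
    have hp5 : p ≠ 5 := by omega
    have h5 : (5 : ZMod p) ≠ 0 := by
      intro e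
      have : p ∣ 5 := (ZMod.natCast_eq_zero_iff 5 p).mp (mod_cast e)
      exact hp5 ((Nat.prime_dvd_prime_iff_eq hp Nat.prime_five).mp this)
    have hp60 : ¬ p ∣ 60 := by
      intro h
      rw [show 60 = 2 * 2 * 3 * 5 from rfl, hp.dvd_mul, hp.dvd_mul, hp.dvd_mul,
        Nat.prime_dvd_prime_iff_eq hp Nat.prime_two, Nat.prime_dvd_prime_iff_eq hp Nat.prime_three,
        Nat.prime_dvd_prime_iff_eq hp Nat.prime_five] at h
      omega
    obtain ⟨γ, hγ⟩ := exists_sq_eq_add_one h2 ((isSquare_five_iff hodd hp5).mpr hmod)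
    obtain ⟨f₁, f₂, hf₁, hf₂, hne, hall⟩ := exists_two_classes h2 h5 hγ
    refine ⟨f₁.range, f₂.range, isMaxAlt5_range hp60 hγ hf₁, isMaxAlt5_range hp60 hγ hf₂, hne, ?_⟩
    intro M hM
    obtain ⟨f, hf, rfl⟩ := exists_injective_range_eq hM.2
    exact hall f hf
  refine ⟨⟨?_, fun h => ?_⟩, main⟩
  · rintro ⟨M, hM, e⟩
    obtain ⟨f, hf, rfl⟩ := exists_injective_range_eq e
    obtain ⟨t, A, B, ht, h, hA, hB⟩ :=
      exists_lift_of_injective hf icoRel_icoB (by decide) (by decide)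
    have hp5 : p ≠ 5 := by
      intro hp5
      refine hM.1 (eq_top_of_prime_dvd_card h2 ht h ⟨_, hA⟩ ⟨_, hB⟩ ?_)
      rw [natCard_range_of_injective hf, hp5]
      decide
    exact (isSquare_five_iff hodd hp5).mp ⟨2 * t - 1, by linear_combination -4 * ht⟩
  · obtain ⟨M, -, hM, -⟩ := main h
    exact ⟨M, hM⟩
end
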